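/- arXiv:1302.1368 — 3 statements merged into one kernel-verified Lean document; each statement's English description precedes it below -/
import Mathlib

section
/- Every locally finite cylindric algebra of dimension ω is representable: if A is a CA_ω such that for every x∈A the dimension set Δx={i<ω : c_i x ≠ x} is finite, then A∈RCA_ω, i.e. A is isomorphic to a subalgebra of a direct product of full cylindric set algebras of dimension ω. -/
universe u v w

/-- An algebra of the similarity type of cylindric algebras, with dimensions
indexed by the type `ι`: a carrier with Boolean-type operations `add` (+),
`mul` (·), `neg` (−), constants `zero` (0), `one` (1), cylindrifications
`c i` and diagonal constants `d i j` (no axioms are assumed). -/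
structure RawCA (ι : Type v) : Type (max (u + 1) v) where
  carrier : Type u
  add : carrier → carrier → carrier
  mul : carrier → carrier → carrier
  neg : carrier → carrier
  zero : carrier
  one : carrier
  c : ι → carrier → carrier
  d : ι → ι → carrier

namespace RawCA

variable {ι : Type v}

/-- The Boolean order:  `x ≤ y` iff `x + y = y`. -/
def le (M : RawCA.{u, v} ι) (x y : M.carrier) : Prop := M.add x y = y

/-- `(A, +, ·, −, 0, 1)` is a Boolean algebra (Huntington's axioms). -/
def IsBoolean (M : RawCA.{u, v} ι) : Prop :=
  (∀ x y, M.add x y = M.add y x) ∧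
  (∀ x y, M.mul x y = M.mul y x) ∧
  (∀ x y z, M.add x (M.mul y z) = M.mul (M.add x y) (M.add x z)) ∧
  (∀ x y z, M.mul x (M.add y z) = M.add (M.mul x y) (M.mul x z)) ∧
  (∀ x, M.add x M.zero = x) ∧
  (∀ x, M.mul x M.one = x) ∧
  (∀ x, M.add x (M.neg x) = M.one) ∧
  (∀ x, M.mul x (M.neg x) = M.zero)

/-- `M` is a cylindric algebra of dimension `ι`: a Boolean algebra with the
cylindric axioms (C1)-(C7). -/
def IsCA (M : RawCA.{u, v} ι) : Prop :=
  M.IsBoolean ∧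
  (∀ i, M.c i M.zero = M.zero) ∧
  (∀ i x, M.le x (M.c i x)) ∧
  (∀ i x y, M.c i (M.mul x (M.c i y)) = M.mul (M.c i x) (M.c i y)) ∧
  (∀ i j x, M.c i (M.c j x) = M.c j (M.c i x)) ∧
  (∀ i, M.d i i = M.one) ∧
  (∀ i j k, i ≠ j → i ≠ k → M.d j k = M.c i (M.mul (M.d j i) (M.d i k))) ∧
  (∀ i j x, i ≠ j →
    M.mul (M.c i (M.mul (M.d i j) x)) (M.c i (M.mul (M.d i j) (M.neg x))) = M.zero)

/-- Homomorphisms for the similarity type of cylindric algebras. -/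
def IsHom (M : RawCA.{u, v} ι) (N : RawCA.{w, v} ι) (f : M.carrier → N.carrier) : Prop :=
  (∀ x y, f (M.add x y) = N.add (f x) (f y)) ∧
  (∀ x y, f (M.mul x y) = N.mul (f x) (f y)) ∧
  (∀ x, f (M.neg x) = N.neg (f x)) ∧
  f M.zero = N.zero ∧
  f M.one = N.one ∧
  (∀ i x, f (M.c i x) = N.c i (f x)) ∧
  (∀ i j, f (M.d i j) = N.d i j)

end RawCA

/-- The cylindrification operation on sets of `ι`-sequences. -/
def cylSet (ι U : Type*) (i : ι) (X : Set (ι → U)) : Set (ι → U) :=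
  {s | ∃ t ∈ X, ∀ j, j ≠ i → t j = s j}

/-- The diagonal elements:  sets of `ι`-sequences with equal `i`-th and `j`-th entries. -/
def diagSet (ι U : Type*) (i j : ι) : Set (ι → U) := {s | s i = s j}

/-- The full cylindric set algebra of dimension `ι` with base `U`. -/
def fullSetAlg (ι : Type v) (U : Type u) : RawCA.{max u v, v} ι where
  carrier := Set (ι → U)
  add X Y := X ∪ Y
  mul X Y := X ∩ Y
  neg X := Xᶜ
  zero := ∅
  one := Set.univ
  c := cylSet ι U
  d := diagSet ι U

/-- The direct product of a family of algebras of the cylindric similarity type. -/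
def prodAlg {ι : Type v} {I : Type w} (F : I → RawCA.{u, v} ι) : RawCA.{max u w, v} ι where
  carrier := ∀ i, (F i).carrier
  add f g := fun i => (F i).add (f i) (g i)
  mul f g := fun i => (F i).mul (f i) (g i)
  neg f := fun i => (F i).neg (f i)
  zero := fun i => (F i).zero
  one := fun i => (F i).one
  c j f := fun i => (F i).c j (f i)
  d j k := fun i => (F i).d j k

/-- `M` is a representable cylindric algebra of dimension `ι` (`M ∈ RCA_ι`):
`M` is isomorphic to a subalgebra of a direct product of full cylindric set
algebras of dimension `ι`. -/
def RawCA.Representable {ι : Type v} (M : RawCA.{u, v} ι) : Prop :=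
  ∃ (I : Type max u v) (U : I → Type max u v)
    (f : M.carrier → (prodAlg fun i => fullSetAlg ι (U i)).carrier),
    Function.Injective f ∧ RawCA.IsHom M (prodAlg fun i => fullSetAlg ι (U i)) f

/-- The cylindric axioms for operations `c` and constants `d` on a Boolean algebra. -/
structure IsCylindric {B : Type u} [BooleanAlgebra B] (c : ℕ → B → B) (d : ℕ → ℕ → B) : Prop where
  c_bot : ∀ i, c i ⊥ = ⊥
  le_c : ∀ i x, x ≤ c i x
  c_inf_c : ∀ i x y, c i (x ⊓ c i y) = c i x ⊓ c i y
  c_comm : ∀ i j x, c i (c j x) = c j (c i x)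
  d_self : ∀ i, d i i = ⊤
  d_eq : ∀ i j k, i ≠ j → i ≠ k → d j k = c i (d j i ⊓ d i k)
  c_disjoint : ∀ i j x, i ≠ j → c i (d i j ⊓ x) ⊓ c i (d i j ⊓ xᶜ) = ⊥

namespace IsCylindric

variable {B : Type u} [BooleanAlgebra B] {c : ℕ → B → B} {d : ℕ → ℕ → B}

theorem c_top (h : IsCylindric c d) (i : ℕ) : c i ⊤ = ⊤ := top_le_iff.1 (h.le_c i ⊤)

theorem c_idem (h : IsCylindric c d) (i : ℕ) (x : B) : c i (c i x) = c i x := by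
  simpa [h.c_top] using h.c_inf_c i ⊤ x

theorem c_inf_of_closed (h : IsCylindric c d) {i : ℕ} {y : B} (hy : c i y = y) (x : B) :
    c i (x ⊓ y) = c i x ⊓ y := by
  simpa [hy] using h.c_inf_c i x y

theorem c_le_of_closed (h : IsCylindric c d) {i : ℕ} {x y : B} (hy : c i y = y) (hxy : x ≤ y) :
    c i x ≤ y := by
  have := h.c_inf_of_closed hy x
  rw [inf_eq_left.2 hxy] at this
  exact inf_eq_left.1 this.symm

theorem c_mono (h : IsCylindric c d) (i : ℕ) {x y : B} (hxy : x ≤ y) : c i x ≤ c i y :=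
  h.c_le_of_closed (h.c_idem i y) (hxy.trans (h.le_c i y))

theorem c_compl_of_closed (h : IsCylindric c d) {i : ℕ} {x : B} (hx : c i x = x) :
    c i xᶜ = xᶜ := by
  refine le_antisymm ?_ (h.le_c i _)
  rw [le_compl_iff_disjoint_right, disjoint_iff, ← h.c_inf_of_closed hx, compl_inf_self, h.c_bot]

theorem c_sup_of_closed (h : IsCylindric c d) {i : ℕ} {x y : B} (hx : c i x = x)
    (hy : c i y = y) : c i (x ⊔ y) = x ⊔ y := by
  have key : c i (xᶜ ⊓ yᶜ) = xᶜ ⊓ yᶜ := by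
    rw [h.c_inf_of_closed (h.c_compl_of_closed hy), h.c_compl_of_closed hx]
  simpa using h.c_compl_of_closed key

theorem c_sup (h : IsCylindric c d) (i : ℕ) (x y : B) : c i (x ⊔ y) = c i x ⊔ c i y := by
  refine le_antisymm ?_ (sup_le (h.c_mono i le_sup_left) (h.c_mono i le_sup_right))
  exact h.c_le_of_closed (h.c_sup_of_closed (h.c_idem i x) (h.c_idem i y))
    (sup_le_sup (h.le_c i x) (h.le_c i y))

theorem c_d (h : IsCylindric c d) {i j : ℕ} (hij : i ≠ j) : c i (d i j) = ⊤ := by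
  rw [← top_le_iff, ← h.d_self j, h.d_eq i j j hij hij]
  exact h.c_mono i inf_le_right

theorem d_le_swap (h : IsCylindric c d) (i j : ℕ) : d i j ≤ d j i := by
  rcases eq_or_ne i j with rfl | hij
  · exact le_rfl
  · have h1 := h.c_disjoint i j (d j i) hij
    rw [inf_comm (d i j), ← h.d_eq i j j hij hij, h.d_self, top_inf_eq] at h1
    have h2 := h.le_c i (d i j ⊓ (d j i)ᶜ)
    rwa [h1, le_bot_iff, ← disjoint_iff, disjoint_compl_right_iff] at h2

theorem d_comm (h : IsCylindric c d) (i j : ℕ) : d i j = d j i :=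
  le_antisymm (h.d_le_swap i j) (h.d_le_swap j i)

theorem d_trans (h : IsCylindric c d) (i j k : ℕ) : d i j ⊓ d j k ≤ d i k := by
  rcases eq_or_ne j i with rfl | hi
  · exact inf_le_right
  rcases eq_or_ne j k with rfl | hk
  · exact inf_le_left
  · rw [h.d_eq j i k hi hk]
    exact h.le_c _ _

theorem c_d_of_ne (h : IsCylindric c d) {i j k : ℕ} (hj : i ≠ j) (hk : i ≠ k) :
    c i (d j k) = d j k := by
  rw [h.d_eq i j k hj hk, h.c_idem]

end IsCylindric

/-- The substitution of the index `j` for the index `i`, meaningful for `i ≠ j`. -/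
def cylSubst {B : Type u} [BooleanAlgebra B] (c : ℕ → B → B) (d : ℕ → ℕ → B) (i j : ℕ) (x : B) : B :=
  c i (d i j ⊓ x)

/-- The successive substitution of `σ i` for `i`, for all `i < n`. -/
def cylSubsts {B : Type u} [BooleanAlgebra B] (c : ℕ → B → B) (d : ℕ → ℕ → B) (σ : ℕ → ℕ) :
    ℕ → B → B
  | 0, x => x
  | n + 1, x => cylSubst c d n (σ n) (cylSubsts c d σ n x)

namespace IsCylindric

variable {B : Type u} [BooleanAlgebra B] {c : ℕ → B → B} {d : ℕ → ℕ → B}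

theorem subst_sup (h : IsCylindric c d) (i j : ℕ) (x y : B) :
    cylSubst c d i j (x ⊔ y) = cylSubst c d i j x ⊔ cylSubst c d i j y := by
  simp only [cylSubst, inf_sup_left, h.c_sup]

theorem subst_mono (h : IsCylindric c d) (i j : ℕ) {x y : B} (hxy : x ≤ y) :
    cylSubst c d i j x ≤ cylSubst c d i j y :=
  h.c_mono i (inf_le_inf_left _ hxy)

theorem subst_compl (h : IsCylindric c d) {i j : ℕ} (hij : i ≠ j) (x : B) :
    cylSubst c d i j xᶜ = (cylSubst c d i j x)ᶜ := by
  refine (IsCompl.compl_eq ⟨disjoint_iff.2 (h.c_disjoint i j x hij), codisjoint_iff.2 ?_⟩).symm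
  rw [← h.c_sup, ← inf_sup_left, sup_compl_eq_top, inf_top_eq, h.c_d hij]

theorem subst_inf (h : IsCylindric c d) {i j : ℕ} (hij : i ≠ j) (x y : B) :
    cylSubst c d i j (x ⊓ y) = cylSubst c d i j x ⊓ cylSubst c d i j y := by
  have := h.subst_sup i j xᶜ yᶜ
  rw [← compl_inf, h.subst_compl hij, h.subst_compl hij, h.subst_compl hij, ← compl_inf] at this
  exact compl_injective this

theorem subst_of_closed (h : IsCylindric c d) {i j : ℕ} (hij : i ≠ j) {x : B} (hx : c i x = x) :
    cylSubst c d i j x = x := by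
  rw [cylSubst, h.c_inf_of_closed hx, h.c_d hij, top_inf_eq]

theorem c_subst_comm (h : IsCylindric c d) {i j k : ℕ} (hi : k ≠ i) (hj : k ≠ j) (x : B) :
    c k (cylSubst c d i j x) = cylSubst c d i j (c k x) := by
  rw [cylSubst, cylSubst, h.c_comm, inf_comm, h.c_inf_of_closed (h.c_d_of_ne hi hj), inf_comm]

theorem c_subst_fresh (h : IsCylindric c d) {i k : ℕ} (hik : i ≠ k) {x : B} (hx : c k x = x) :
    c k (cylSubst c d i k x) = c i x := by
  rw [cylSubst, h.c_comm, h.c_inf_of_closed hx, h.d_comm, h.c_d hik.symm, top_inf_eq]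

theorem subst_d (h : IsCylindric c d) {i j : ℕ} (hij : i ≠ j) (k l : ℕ) :
    cylSubst c d i j (d k l) = d (if k = i then j else k) (if l = i then j else l) := by
  split_ifs with hk hl hl
  · subst hk hl
    rw [h.d_self, h.d_self, cylSubst, inf_top_eq, h.c_d hij]
  · subst hk
    rw [cylSubst, h.d_comm k j, ← h.d_eq k j l hij (Ne.symm hl)]
  · subst hl
    rw [cylSubst, inf_comm, ← h.d_eq l k j (Ne.symm hk) hij]
  · exact h.subst_of_closed hij (h.c_d_of_ne (Ne.symm hk) (Ne.symm hl))

theorem d_inf_subst_le (h : IsCylindric c d) {i j k : ℕ} (hj : i ≠ j) (hk : i ≠ k) (x : B) :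
    d j k ⊓ cylSubst c d i j x ≤ cylSubst c d i k x := by
  rw [cylSubst, inf_comm, ← h.c_inf_of_closed (h.c_d_of_ne hj hk)]
  refine h.c_mono i (le_inf ((le_inf ?_ ?_).trans (h.d_trans i j k)) ?_)
  · exact inf_le_left.trans inf_le_left
  · exact inf_le_right
  · exact inf_le_left.trans inf_le_right

theorem substs_compl (h : IsCylindric c d) {σ : ℕ → ℕ} {n : ℕ} (hσ : ∀ i, n ≤ σ i) (x : B) :
    cylSubsts c d σ n xᶜ = (cylSubsts c d σ n x)ᶜ := by
  suffices ∀ m ≤ n, cylSubsts c d σ m xᶜ = (cylSubsts c d σ m x)ᶜ from this n le_rfl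
  intro m hm
  induction m with
  | zero => rfl
  | succ m ih =>
    simp only [cylSubsts]
    rw [ih (by lia), h.subst_compl (by have := hσ m; lia)]

theorem substs_inf (h : IsCylindric c d) {σ : ℕ → ℕ} {n : ℕ} (hσ : ∀ i, n ≤ σ i) (x y : B) :
    cylSubsts c d σ n (x ⊓ y) = cylSubsts c d σ n x ⊓ cylSubsts c d σ n y := by
  suffices ∀ m ≤ n, cylSubsts c d σ m (x ⊓ y) = cylSubsts c d σ m x ⊓ cylSubsts c d σ m y from
    this n le_rfl
  intro m hm
  induction m with
  | zero => rfl
  | succ m ih =>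
    simp only [cylSubsts]
    rw [ih (by lia), h.subst_inf (by have := hσ m; lia)]

theorem substs_of_closed (h : IsCylindric c d) {σ : ℕ → ℕ} {n : ℕ} (hσ : ∀ i, n ≤ σ i) {x : B}
    (hx : ∀ i, c i x = x) : cylSubsts c d σ n x = x := by
  suffices ∀ m ≤ n, cylSubsts c d σ m x = x from this n le_rfl
  intro m hm
  induction m with
  | zero => rfl
  | succ m ih =>
    rw [cylSubsts, ih (by lia), h.subst_of_closed (by have := hσ m; lia) (hx m)]

theorem substs_d (h : IsCylindric c d) {σ : ℕ → ℕ} {n : ℕ} (hσ : ∀ i, n ≤ σ i) {i j : ℕ}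
    (hi : i < n) (hj : j < n) : cylSubsts c d σ n (d i j) = d (σ i) (σ j) := by
  suffices ∀ m ≤ n, cylSubsts c d σ m (d i j) =
      d (if i < m then σ i else i) (if j < m then σ j else j) by
    simpa [hi, hj] using this n le_rfl
  intro m hm
  induction m with
  | zero => simp [cylSubsts]
  | succ m ih =>
    have h1 := hσ i
    have h2 := hσ j
    rw [cylSubsts, ih (by lia), h.subst_d (by have := hσ m; lia)]
    congr 1 <;> grind

theorem substs_congr {σ τ : ℕ → ℕ} {n : ℕ} (hστ : ∀ i < n, σ i = τ i) (x : B) :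
    cylSubsts c d σ n x = cylSubsts c d τ n x := by
  induction n with
  | zero => rfl
  | succ n ih => rw [cylSubsts, cylSubsts, ih fun i hi => hστ i (by lia), hστ n (by lia)]

theorem c_substs_comm (h : IsCylindric c d) {σ : ℕ → ℕ} {n k : ℕ} (hk : n ≤ k)
    (hσ : ∀ i < n, k ≠ σ i) (x : B) :
    c k (cylSubsts c d σ n x) = cylSubsts c d σ n (c k x) := by
  induction n with
  | zero => rfl
  | succ n ih =>
    rw [cylSubsts, cylSubsts, h.c_subst_comm (by lia) (hσ n (by lia)),
      ih (by lia) fun i hi => hσ i (by lia)]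

theorem substs_c (h : IsCylindric c d) {σ : ℕ → ℕ} {n i k : ℕ} (hσ : ∀ i, n ≤ σ i) (hi : i < n)
    (hk : n ≤ k) (hkσ : ∀ i < n, k ≠ σ i) {x : B} (hx : c k x = x) :
    cylSubsts c d σ n (c i x) = c k (cylSubsts c d (Function.update σ i k) n x) := by
  have hi_eq : cylSubsts c d (Function.update σ i k) i x = cylSubsts c d σ i x :=
    substs_congr (fun j hj => Function.update_of_ne hj.ne _ _) x
  suffices ∀ m, i + 1 ≤ m → m ≤ n →
      cylSubsts c d σ m (c i x) = c k (cylSubsts c d (Function.update σ i k) m x) from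
    this n hi le_rfl
  intro m him hm
  induction m, him using Nat.le_induction with
  | base =>
    have h1 : cylSubsts c d σ i (c i x) = c i (cylSubsts c d σ i x) :=
      (h.c_substs_comm le_rfl (fun j hj => by have := hσ j; lia) x).symm
    have h2 : c k (cylSubsts c d σ i x) = cylSubsts c d σ i x := by
      rw [h.c_substs_comm (by lia) (fun j hj => hkσ j (by lia)), hx]
    rw [cylSubsts, cylSubsts, h1, hi_eq, Function.update_self, h.c_subst_fresh (by lia) h2,
      h.subst_of_closed (by have := hσ i; lia) (h.c_idem i _)]
  | succ m him ih =>
    rw [cylSubsts, cylSubsts, ih (by lia), Function.update_of_ne (by lia),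
      h.c_subst_comm (by lia) (hkσ m (by lia))]

theorem d_inf_substs_le (h : IsCylindric c d) {σ : ℕ → ℕ} {n i j k : ℕ} (hσ : ∀ i, n ≤ σ i)
    (hj : n ≤ j) (hk : n ≤ k) (x : B) :
    d j k ⊓ cylSubsts c d (Function.update σ i j) n x ≤
      cylSubsts c d (Function.update σ i k) n x := by
  suffices ∀ m ≤ n, d j k ⊓ cylSubsts c d (Function.update σ i j) m x ≤
      cylSubsts c d (Function.update σ i k) m x from this n le_rfl
  intro m hm
  induction m with
  | zero => exact inf_le_right
  | succ m ih =>
    rw [cylSubsts, cylSubsts]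
    have key : ∀ l, n ≤ l → d j k ⊓
        cylSubst c d m l (cylSubsts c d (Function.update σ i j) m x) ≤
        cylSubst c d m l (cylSubsts c d (Function.update σ i k) m x) := by
      intro l hl
      have h1 := h.subst_mono m l (ih (by lia))
      rwa [h.subst_inf (by lia),
        h.subst_of_closed (by lia) (h.c_d_of_ne (by lia) (by lia))] at h1
    rcases eq_or_ne m i with rfl | hmi
    · rw [Function.update_self, Function.update_self]
      exact (le_inf inf_le_left (key j hj)).trans (h.d_inf_subst_le (by lia) (by lia) _)
    · rw [Function.update_of_ne hmi, Function.update_of_ne hmi]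
      exact key _ (hσ m)

end IsCylindric

/-- For finitely many elements with finite dimension sets and finitely many forbidden indices, some
index is outside all of them. -/
theorem exists_fresh_index {B : Type*} {c : ℕ → B → B} (hlf : ∀ x, {i | c i x ≠ x}.Finite)
    (x y : B) (n : ℕ) (σ τ : ℕ → ℕ) :
    ∃ k, n ≤ k ∧ (∀ i < n, k ≠ σ i) ∧ (∀ i < n, k ≠ τ i) ∧ c k x = x ∧ c k y = y := by
  have hfin : (Set.Iio n ∪ σ '' Set.Iio n ∪ τ '' Set.Iio n ∪ {i | c i x ≠ x} ∪
      {i | c i y ≠ y}).Finite :=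
    ((((Set.finite_Iio n).union ((Set.finite_Iio n).image σ)).union
      ((Set.finite_Iio n).image τ)).union (hlf x)).union (hlf y)
  obtain ⟨k, hk⟩ := hfin.exists_notMem
  simp only [Set.mem_union, not_or, Set.mem_image, Set.mem_Iio, Set.mem_ofPred_eq, not_not,
    not_lt, not_exists, not_and] at hk
  exact ⟨k, hk.1.1.1.1, fun i hi e => hk.1.1.1.2 i hi e.symm, fun i hi e => hk.1.1.2 i hi e.symm,
    hk.1.2, hk.2⟩

/-- Rasiowa–Sikorski: a nonzero element lies in an ultrafilter, given by its membership predicate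
`P`, which realizes countably many countable joins `y t = ⨆ j, z t j`. -/
theorem exists_ultrafilter_of_countable {B T J : Type*} [BooleanAlgebra B]
    [Countable T] (y : T → B) (z : T → J → B)
    (hyz : ∀ p t, p ≠ ⊥ → p ≤ y t → ∃ j, p ⊓ z t j ≠ ⊥) (a : B) (ha : a ≠ ⊥) :
    ∃ P : B → Prop, P a ∧ (∀ x y, P (x ⊓ y) ↔ P x ∧ P y) ∧ (∀ x, P xᶜ ↔ ¬ P x) ∧
      ∀ t, P (y t) → ∃ j, P (z t j) := by
  have := Encodable.ofCountable T
  let D (t : T) : Order.Cofinal {b : B // b ≠ ⊥}ᵒᵈ :=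
    { carrier := {q | q.ofDual.1 ≤ (y t)ᶜ ∨ ∃ j, q.ofDual.1 ≤ z t j}
      isCofinal := by
        intro p
        by_cases hp : p.ofDual.1 ≤ y t
        · obtain ⟨j, hj⟩ := hyz _ t p.ofDual.2 hp
          exact ⟨OrderDual.toDual ⟨_, hj⟩, Or.inr ⟨j, inf_le_right⟩,
            show p.ofDual.1 ⊓ z t j ≤ p.ofDual.1 from inf_le_left⟩
        · refine ⟨OrderDual.toDual ⟨p.ofDual.1 ⊓ (y t)ᶜ, ?_⟩, Or.inl inf_le_right,
            show p.ofDual.1 ⊓ (y t)ᶜ ≤ p.ofDual.1 from inf_le_left⟩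
          rwa [ne_eq, ← disjoint_iff, disjoint_compl_right_iff] }
  let s := Order.sequenceOfCofinals (OrderDual.toDual (⟨a, ha⟩ : {b : B // b ≠ ⊥})) D
  have hs : ∀ {m n}, m ≤ n → (s n).ofDual.1 ≤ (s m).ofDual.1 := fun hmn =>
    Order.sequenceOfCofinals.monotone _ D hmn
  have hF : Order.IsPFilter {b : B | ∃ n, (s n).ofDual.1 ≤ b} := by
    refine Order.IsPFilter.of_def ⟨a, 0, le_rfl⟩ ?_ fun hxy ⟨n, hn⟩ => ⟨n, hn.trans hxy⟩
    rintro x ⟨m, hm⟩ y ⟨n, hn⟩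
    exact ⟨_, ⟨max m n, le_rfl⟩, (hs (le_max_left m n)).trans hm,
      (hs (le_max_right m n)).trans hn⟩
  obtain ⟨J, hJ, -, hFJ⟩ := DistribLattice.prime_ideal_of_disjoint_filter_ideal
    (F := hF.toPFilter) (I := Order.Ideal.principal ⊥) <| by
      rw [Set.disjoint_left]
      rintro x ⟨n, hn⟩ hx
      exact (s n).ofDual.2 (le_bot_iff.1 (hn.trans hx))
  have hmem : ∀ n b, (s n).ofDual.1 ≤ b → b ∉ J := fun n b hb =>
    Set.disjoint_left.1 hFJ (show b ∈ hF.toPFilter from ⟨n, hb⟩)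
  have htop : (⊤ : B) ∉ J := hmem 0 ⊤ le_top
  have hcompl : ∀ x, xᶜ ∉ J ↔ ¬ x ∉ J := fun x => by
    refine ⟨fun h => not_not.2 (hJ.mem_or_compl_mem.resolve_right h), fun h h' => htop ?_⟩
    rw [← sup_compl_eq_top (x := x)]
    exact Order.Ideal.sup_mem (not_not.1 h) h'
  refine ⟨(· ∉ J), hmem 0 a le_rfl, fun x y => ?_, hcompl, fun t ht => ?_⟩
  · refine ⟨fun h => ⟨fun hx => h (J.lower inf_le_left hx), fun hy => h (J.lower inf_le_right hy)⟩,
      fun ⟨hx, hy⟩ h => (hJ.mem_or_mem h).elim hx hy⟩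
  · obtain h | ⟨j, hj⟩ := Order.sequenceOfCofinals.encode_mem _ D t
    · exact absurd ht ((hcompl _).1 (hmem _ _ h))
    · exact ⟨j, hmem _ _ hj⟩

namespace IsCylindric

variable {B : Type u} [BooleanAlgebra B] {c : ℕ → B → B} {d : ℕ → ℕ → B}

/-- `cylSubsts c d σ n (c i x)` does not depend on `σ i`. -/
theorem substs_c_congr (h : IsCylindric c d) (hlf : ∀ x, {i | c i x ≠ x}.Finite) {σ τ : ℕ → ℕ}
    {n i : ℕ} (hσ : ∀ i, n ≤ σ i) (hτ : ∀ i, n ≤ τ i) (hi : i < n) (hστ : ∀ j ≠ i, σ j = τ j)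
    (x : B) : cylSubsts c d σ n (c i x) = cylSubsts c d τ n (c i x) := by
  obtain ⟨k, hk, hkσ, hkτ, hx, -⟩ := exists_fresh_index hlf x x n σ τ
  rw [h.substs_c hσ hi hk hkσ hx, h.substs_c hτ hi hk hkτ hx]
  congr 2
  ext j
  rcases eq_or_ne j i with rfl | hj
  · simp
  · simp [hj, hστ j hj]

theorem substs_mono (h : IsCylindric c d) {σ : ℕ → ℕ} {n : ℕ} (hσ : ∀ i, n ≤ σ i) {x y : B}
    (hxy : x ≤ y) : cylSubsts c d σ n x ≤ cylSubsts c d σ n y := by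
  rw [← inf_eq_left, ← h.substs_inf hσ, inf_eq_left.2 hxy]

/-- For finitely many elements and finitely many indices, an ultrafilter with Henkin witnesses
among the indices `≥ n`. -/
theorem exists_henkin_ultrafilter (h : IsCylindric c d) (hlf : ∀ x, {i | c i x ≠ x}.Finite)
    (a : B) (ha : a ≠ ⊥) (S : Finset B) (n : ℕ) :
    ∃ P : B → Prop, P a ∧ (∀ x y, P (x ⊓ y) ↔ P x ∧ P y) ∧ (∀ x, P xᶜ ↔ ¬ P x) ∧
      ∀ x ∈ S, ∀ i < n, ∀ τ : ℕ → ℕ, P (cylSubsts c d (fun m => n + τ m) n (c i x)) →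
        ∃ j, P (cylSubsts c d (fun m => n + Function.update τ i j m) n x) := by
  let ext (l : Fin n → ℕ) (m : ℕ) : ℕ := if hm : m < n then l ⟨m, hm⟩ else 0
  have hupd : ∀ (τ : ℕ → ℕ) i j, (fun m => n + Function.update τ i j m) =
      Function.update (fun m => n + τ m) i (n + j) := fun τ i j => by
    ext m
    rcases eq_or_ne m i with rfl | hm <;> simp [*]
  obtain ⟨P, hPa, hinf, hcompl, hP⟩ := exists_ultrafilter_of_countable
    (T := S × Fin n × (Fin n → ℕ))
    (fun t => cylSubsts c d (fun m => n + ext t.2.2 m) n (c t.2.1 t.1))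
    (fun t j => cylSubsts c d (fun m => n + Function.update (ext t.2.2) t.2.1 j m) n t.1)
    (by
      rintro p ⟨x, i, l⟩ hp hle
      have hσ : ∀ m, n ≤ n + ext l m := fun m => Nat.le_add_right _ _
      obtain ⟨k, hk, hkσ, -, hx, hkp⟩ := exists_fresh_index hlf x.1 p n (fun m => n + ext l m) id
      obtain ⟨j, rfl⟩ := Nat.exists_eq_add_of_le hk
      refine ⟨j, fun hbot => hp ?_⟩
      simp only at hbot hle
      have := congrArg (c (n + j)) hbot
      rw [h.c_bot, inf_comm, h.c_inf_of_closed hkp, hupd, ← h.substs_c hσ i.2 hk hkσ hx] at this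
      rwa [inf_eq_right.2 hle] at this) a ha
  refine ⟨P, hPa, hinf, hcompl, fun x hx i hi τ hτ => ?_⟩
  have hext : ∀ m < n, ext (fun m => τ m) m = τ m := fun m hm => by simp [ext, hm]
  obtain ⟨j, hj⟩ := hP (⟨x, hx⟩, ⟨i, hi⟩, fun m => τ m) <| by
    rwa [substs_congr (τ := fun m => n + τ m) fun m hm => by rw [hext m hm]]
  refine ⟨j, ?_⟩
  rwa [substs_congr (τ := fun m => n + Function.update τ i j m)] at hj
  intro m hm
  rcases eq_or_ne m i with rfl | hmi
  · simp
  · simp [hmi, hext m hm]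

/-- Every nonzero element closed under all cylindrifications is mapped to a nonempty set by some
homomorphism to a full cylindric set algebra. -/
theorem exists_hom_of_closed (h : IsCylindric c d) (hlf : ∀ x, {i | c i x ≠ x}.Finite)
    (a : B) (ha : a ≠ ⊥) (hac : ∀ i, c i a = a) :
    ∃ (U : Type u) (f : B → Set (ℕ → U)), (f a).Nonempty ∧
      (∀ x y, f (x ⊓ y) = f x ∩ f y) ∧ (∀ x, f xᶜ = (f x)ᶜ) ∧
      (∀ i x, f (c i x) = cylSet ℕ U i (f x)) ∧ ∀ i j, f (d i j) = diagSet ℕ U i j := by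
  classical
  let I := Finset B × ℕ
  choose P hPa hinf hcompl hP using fun p : I => h.exists_henkin_ultrafilter hlf a ha p.1 p.2
  have hmono : ∀ p x y, x ≤ y → P p x → P p y := fun p x y hxy hx => by
    rw [← inf_eq_left.2 hxy, hinf] at hx
    exact hx.2
  let 𝒰 : Ultrafilter I := Ultrafilter.of Filter.atTop
  have h𝒰 : ∀ p : I, ∀ᶠ q in (𝒰 : Filter I), p ≤ q := fun p =>
    Ultrafilter.of_le Filter.atTop (Filter.eventually_ge_atTop p)
  have hlt : ∀ i : ℕ, ∀ᶠ p in (𝒰 : Filter I), i < p.2 := fun i =>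
    (h𝒰 (∅, i + 1)).mono fun p hp => hp.2
  have hmemS : ∀ x : B, ∀ᶠ p in (𝒰 : Filter I), x ∈ p.1 := fun x =>
    (h𝒰 ({x}, 0)).mono fun p hp => hp.1 (Finset.mem_singleton_self x)
  let r : Setoid (I → ℕ) :=
    { r := fun f g => ∀ᶠ p in (𝒰 : Filter I), P p (d (p.2 + f p) (p.2 + g p))
      iseqv :=
        { refl := fun f => Filter.Eventually.of_forall fun p => by
            rw [h.d_self]
            exact hmono p a ⊤ le_top (hPa p)
          symm := fun {f g} hfg => hfg.mono fun p hp => by rwa [h.d_comm]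
          trans := fun {f g k} hfg hgk => by
            filter_upwards [hfg, hgk] with p h1 h2
            exact hmono p _ _ (h.d_trans _ _ _) ((hinf _ _ _).2 ⟨h1, h2⟩) } }
  let τ (s : ℕ → Quotient r) (p : I) (m : ℕ) : ℕ := (s m).out p
  let σ (s : ℕ → Quotient r) (p : I) (m : ℕ) : ℕ := p.2 + τ s p m
  have hσ : ∀ s p m, p.2 ≤ σ s p m := fun s p m => Nat.le_add_right _ _
  refine ⟨Quotient r, fun x => {s | ∀ᶠ p in (𝒰 : Filter I), P p (cylSubsts c d (σ s p) p.2 x)},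
    ⟨fun _ => ⟦fun _ => 0⟧, ?_⟩, ?_, ?_, ?_, ?_⟩
  · refine Filter.Eventually.of_forall fun p => ?_
    rw [h.substs_of_closed (hσ _ p) hac]
    exact hPa p
  · intro x y
    ext s
    simp only [Set.mem_ofPred_eq, Set.mem_inter_iff, ← Filter.eventually_and]
    refine Filter.eventually_congr (Filter.Eventually.of_forall fun p => ?_)
    rw [h.substs_inf (hσ s p), hinf]
  · intro x
    ext s
    simp only [Set.mem_ofPred_eq, Set.mem_compl_iff, ← Ultrafilter.eventually_not]
    refine Filter.eventually_congr (Filter.Eventually.of_forall fun p => ?_)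
    rw [h.substs_compl (hσ s p), hcompl]
  · intro i x
    ext s
    constructor
    · intro hs
      have hex : ∀ p, ∃ j, P p (cylSubsts c d (σ s p) p.2 (c i x)) → x ∈ p.1 → i < p.2 →
          P p (cylSubsts c d (fun m => p.2 + Function.update (τ s p) i j m) p.2 x) := fun p => by
        by_cases hp : P p (cylSubsts c d (σ s p) p.2 (c i x)) ∧ x ∈ p.1 ∧ i < p.2
        · obtain ⟨j, hj⟩ := hP p x hp.2.1 i hp.2.2 (τ s p) hp.1
          exact ⟨j, fun _ _ _ => hj⟩
        · exact ⟨0, fun h1 h2 h3 => absurd ⟨h1, h2, h3⟩ hp⟩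
      choose f hf using hex
      refine ⟨Function.update s i ⟦f⟧, ?_, fun j hj => Function.update_of_ne hj _ _⟩
      have heq : ∀ᶠ p in (𝒰 : Filter I),
          P p (d (p.2 + f p) (p.2 + (⟦f⟧ : Quotient r).out p)) :=
        r.symm (Quotient.mk_out (s := r) f)
      filter_upwards [hs, hmemS x, hlt i, heq] with p h1 h2 h3 h4
      have h5 := (hinf _ _ _).2 ⟨h4, hf p h1 h2 h3⟩
      have e1 : (fun m => p.2 + Function.update (τ s p) i (f p) m) =
          Function.update (σ s p) i (p.2 + f p) := by
        ext m
        rcases eq_or_ne m i with rfl | hm <;> simp [σ, *]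
      have e2 : σ (Function.update s i ⟦f⟧) p =
          Function.update (σ s p) i (p.2 + (⟦f⟧ : Quotient r).out p) := by
        ext m
        rcases eq_or_ne m i with rfl | hm <;> simp [σ, τ, *]
      rw [e1] at h5
      rw [e2]
      exact hmono p _ _ (h.d_inf_substs_le (hσ s p) (Nat.le_add_right _ _)
        (Nat.le_add_right _ _) x) h5
    · rintro ⟨t, ht, hts⟩
      filter_upwards [ht, hlt i] with p hp hi
      rw [h.substs_c_congr hlf (hσ s p) (hσ t p) hi (fun j hj => by simp only [σ, τ, hts j hj])]
      exact hmono p _ _ (h.substs_mono (hσ t p) (h.le_c i x)) hp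
  · intro i j
    ext s
    have : s ∈ diagSet ℕ (Quotient r) i j ↔ r (s i).out (s j).out :=
      Quotient.out_equiv_out.symm
    rw [this]
    refine Filter.eventually_congr ?_
    filter_upwards [hlt i, hlt j] with p hi hj
    rw [h.substs_d (hσ s p) hi hj]

/-- Every nonzero element is mapped to a nonempty set by some homomorphism to a full cylindric
set algebra. -/
theorem exists_hom (h : IsCylindric c d) (hlf : ∀ x, {i | c i x ≠ x}.Finite)
    (a : B) (ha : a ≠ ⊥) :
    ∃ (U : Type u) (f : B → Set (ℕ → U)), (f a).Nonempty ∧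
      (∀ x y, f (x ⊓ y) = f x ∩ f y) ∧ (∀ x, f xᶜ = (f x)ᶜ) ∧
      (∀ i x, f (c i x) = cylSet ℕ U i (f x)) ∧ ∀ i j, f (d i j) = diagSet ℕ U i j := by
  obtain ⟨n, hn⟩ := (hlf a).bddAbove
  let e (m : ℕ) : B := Nat.rec a (fun i x => c i x) m
  have hle : ∀ m, a ≤ e m := fun m => by
    induction m with
    | zero => exact le_rfl
    | succ m ih => exact ih.trans (h.le_c m _)
  have hclosed : ∀ m i, (i < m ∨ n < i) → c i (e m) = e m := fun m => by
    induction m with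
    | zero =>
      intro i hi
      by_contra hne
      exact absurd (hn hne) (by lia)
    | succ m ih =>
      intro i hi
      change c i (c m (e m)) = c m (e m)
      rcases eq_or_ne i m with rfl | him
      · exact h.c_idem _ _
      · rw [h.c_comm, ih i (by lia)]
  obtain ⟨U, f, hne, hinf, hcompl, hc, hd⟩ := h.exists_hom_of_closed hlf (e (n + 1))
    (fun hbot => ha (le_bot_iff.1 (hbot ▸ hle (n + 1)))) fun i => hclosed (n + 1) i (by lia)
  refine ⟨U, f, ?_, hinf, hcompl, hc, hd⟩
  suffices ∀ m, (f (e m)).Nonempty → (f a).Nonempty from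
    this (n + 1) hne
  intro m
  induction m with
  | zero => exact id
  | succ m ih =>
    intro hm
    change (f (c m (e m))).Nonempty at hm
    rw [hc] at hm
    obtain ⟨s, t, ht, -⟩ := hm
    exact ih ⟨t, ht⟩

end IsCylindric

theorem huntington_annihilator {α : Type*} {add mul : α → α → α} {neg : α → α} {one : α}
    (mul_comm : ∀ x y, mul x y = mul y x)
    (add_mul : ∀ x y z, add x (mul y z) = mul (add x y) (add x z))
    (mul_one : ∀ x, mul x one = x) (add_neg : ∀ x, add x (neg x) = one) (x : α) :
    add x one = one := by
  calc
    add x one = mul (add x (neg x)) (add x one) := by rw [add_neg, mul_comm, mul_one]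
    _ = one := by rw [← add_mul, mul_one, add_neg]

theorem huntington_absorption {α : Type*} {add mul : α → α → α} {neg : α → α} {one : α}
    (add_comm : ∀ x y, add x y = add y x) (mul_comm : ∀ x y, mul x y = mul y x)
    (add_mul : ∀ x y z, add x (mul y z) = mul (add x y) (add x z))
    (mul_add : ∀ x y z, mul x (add y z) = add (mul x y) (mul x z))
    (mul_one : ∀ x, mul x one = x) (add_neg : ∀ x, add x (neg x) = one) (x y : α) :
    add x (mul x y) = x := by
  calc
    add x (mul x y) = mul x (add y one) := by rw [mul_add, mul_one, add_comm]
    _ = x := by rw [huntington_annihilator mul_comm add_mul mul_one add_neg, mul_one]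

theorem huntington_assoc {α : Type*} {add mul : α → α → α} {neg : α → α} {zero one : α}
    (add_comm : ∀ x y, add x y = add y x) (mul_comm : ∀ x y, mul x y = mul y x)
    (add_mul : ∀ x y z, add x (mul y z) = mul (add x y) (add x z))
    (mul_add : ∀ x y z, mul x (add y z) = add (mul x y) (mul x z))
    (add_zero : ∀ x, add x zero = x) (mul_one : ∀ x, mul x one = x)
    (add_neg : ∀ x, add x (neg x) = one) (mul_neg : ∀ x, mul x (neg x) = zero) (x y z : α) :
    add (add x y) z = add x (add y z) := by
  have absorb := huntington_absorption add_comm mul_comm add_mul mul_add mul_one add_neg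
  have absorb' := huntington_absorption mul_comm add_comm mul_add add_mul add_zero mul_neg
  have split : ∀ u v, mul u x = mul v x → mul u (neg x) = mul v (neg x) → u = v :=
    fun u v h1 h2 => by
      rw [← mul_one u, ← mul_one v, ← add_neg x, mul_add, mul_add, h1, h2]
  have drop : ∀ w, mul (neg x) (add x w) = mul (neg x) w := fun w => by
    rw [mul_add, mul_comm _ x, mul_neg, add_comm, add_zero]
  apply split
  · rw [mul_comm, mul_add, absorb', absorb, mul_comm, absorb']
  · rw [mul_comm, mul_add, drop, ← mul_add, mul_comm _ (neg x), drop]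

/-- The Boolean algebra given by Huntington's axioms. -/
abbrev RawCA.IsBoolean.toBooleanAlgebra {ι : Type v} {M : RawCA.{u, v} ι} (hM : M.IsBoolean) :
    BooleanAlgebra M.carrier :=
  have add_comm := hM.1
  have mul_comm := hM.2.1
  have add_mul := hM.2.2.1
  have mul_add := hM.2.2.2.1
  have add_zero := hM.2.2.2.2.1
  have mul_one := hM.2.2.2.2.2.1
  have add_neg := hM.2.2.2.2.2.2.1
  have mul_neg := hM.2.2.2.2.2.2.2
  letI : Max M.carrier := ⟨M.add⟩
  letI : Min M.carrier := ⟨M.mul⟩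
  letI : Lattice M.carrier := Lattice.mk' add_comm
    (huntington_assoc add_comm mul_comm add_mul mul_add add_zero mul_one add_neg mul_neg)
    mul_comm
    (huntington_assoc mul_comm add_comm mul_add add_mul mul_one add_zero mul_neg add_neg)
    (huntington_absorption add_comm mul_comm add_mul mul_add mul_one add_neg)
    (huntington_absorption mul_comm add_comm mul_add add_mul add_zero mul_neg)
  { le_sup_inf := fun x y z => (add_mul x y z).ge
    compl := M.neg
    top := M.one
    bot := M.zero
    sdiff_eq := fun _ _ => rfl
    himp_eq := fun _ _ => rfl
    inf_compl_le_bot := fun x => (mul_neg x).le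
    top_le_sup_compl := fun x => (add_neg x).ge
    le_top := fun x => huntington_annihilator mul_comm add_mul mul_one add_neg x
    bot_le := fun x => (add_comm _ _).trans (add_zero x) }

/-- **Tarski's theorem.** Every locally finite cylindric algebra of dimension
ω is representable: if `A` is a `CA_ω` such that for every `x ∈ A` the
dimension set `Δx = {i < ω : c_i x ≠ x}` is finite, then `A ∈ RCA_ω`, i.e.
`A` is isomorphic to a subalgebra of a direct product of full cylindric set
algebras of dimension ω. -/
theorem locally_finite_CA_omega_representable (A : RawCA.{u, 0} ℕ) (hA : A.IsCA)
    (hlf : ∀ x : A.carrier, {i : ℕ | A.c i x ≠ x}.Finite) :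
    A.Representable := by
  obtain ⟨hB, c_zero, le_c, c_mul_c, c_comm, d_self, d_eq, c_disjoint⟩ := hA
  let : BooleanAlgebra A.carrier := RawCA.IsBoolean.toBooleanAlgebra hB
  have h : IsCylindric A.c A.d :=
    ⟨c_zero, le_c, c_mul_c, c_comm, d_self, fun i j k => d_eq i j k, c_disjoint⟩
  choose U f hne hinf hcompl hc hd using
    fun a : {a : A.carrier // a ≠ ⊥} => h.exists_hom hlf a.1 a.2
  have hbot : ∀ a, f a ⊥ = ∅ := fun a => by
    rw [← inf_compl_self (⊥ : A.carrier), hinf, hcompl, Set.inter_compl_self]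
  have hle : ∀ x y : A.carrier, (∀ a, f a x = f a y) → x ≤ y := fun x y hxy => by
    by_contra hne_le
    have hz : x ⊓ yᶜ ≠ ⊥ := by rwa [ne_eq, ← disjoint_iff, disjoint_compl_right_iff]
    have := hne ⟨_, hz⟩
    rw [hinf, hcompl, hxy, Set.inter_compl_self] at this
    exact Set.not_nonempty_empty this
  refine ⟨{a : A.carrier // a ≠ ⊥}, U, fun x a => f a x, fun x y hxy => ?_, ?_, ?_, ?_, ?_, ?_,
    ?_, ?_⟩
  · exact le_antisymm (hle x y fun a => congrFun hxy a) (hle y x fun a => (congrFun hxy a).symm)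
  · intro x y
    funext a
    change f a (x ⊔ y) = f a x ∪ f a y
    rw [← compl_compl (x ⊔ y), compl_sup, hcompl, hinf, hcompl, hcompl, ← Set.compl_union,
      compl_compl]
  · exact fun x y => funext fun a => hinf a x y
  · exact fun x => funext fun a => hcompl a x
  · exact funext hbot
  · funext a
    change f a ⊤ = Set.univ
    rw [← compl_bot, hcompl, hbot, Set.compl_empty]
  · exact fun i x => funext fun a => hc a i x
  · exact fun i j => funext fun a => hd a i j
end

section
/- Henkin's Neat Embedding Theorem: for every ordinal α and every cylindric algebra A of dimension α, A is representable (A∈RCA_α) if and only if A is embeddable into the neat α-reduct of some cylindric algebra of dimension α+ω; that is, RCA_α = S Nr_α CA_{α+ω}. -/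
universe u v w

/-- `f` neatly embeds `M` into the `ι`-neat reduct of `C` along the dimension
map `u : ι → κ`:  `f` is an injective homomorphism of `ι`-dimensional
cylindric algebras from `M` into the algebra `Nr C` of `u`-neat elements of
`C` (those fixed by every cylindrification whose index is outside the range
of `u`). -/
def IsNeatEmbedding {ι : Type*} {κ : Type*} (M : RawCA ι) (C : RawCA κ)
    (u : ι → κ) (f : M.carrier → C.carrier) : Prop :=
  Function.Injective f ∧
  (∀ x y, f (M.add x y) = C.add (f x) (f y)) ∧
  (∀ x y, f (M.mul x y) = C.mul (f x) (f y)) ∧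
  (∀ x, f (M.neg x) = C.neg (f x)) ∧
  f M.zero = C.zero ∧
  f M.one = C.one ∧
  (∀ i x, f (M.c i x) = C.c (u i) (f x)) ∧
  (∀ i j, f (M.d i j) = C.d (u i) (u j)) ∧
  (∀ x k, k ∉ Set.range u → C.c k (f x) = f x)

/-- Huntington's postulates for a Boolean algebra, stated for bare operations. -/
structure Huntington {α : Type*} (add mul : α → α → α) (neg : α → α) (zero one : α) : Prop where
  add_comm : ∀ x y, add x y = add y x
  mul_comm : ∀ x y, mul x y = mul y x
  add_mul : ∀ x y z, add x (mul y z) = mul (add x y) (add x z)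
  mul_add : ∀ x y z, mul x (add y z) = add (mul x y) (mul x z)
  add_zero : ∀ x, add x zero = x
  mul_one : ∀ x, mul x one = x
  add_neg : ∀ x, add x (neg x) = one
  mul_neg : ∀ x, mul x (neg x) = zero

namespace Huntington

variable {α : Type*} {add mul : α → α → α} {neg : α → α} {zero one : α}

theorem dual (h : Huntington add mul neg zero one) : Huntington mul add neg one zero :=
  ⟨h.mul_comm, h.add_comm, h.mul_add, h.add_mul, h.mul_one, h.add_zero, h.mul_neg, h.add_neg⟩

theorem add_one (h : Huntington add mul neg zero one) (x : α) : add x one = one := by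
  rw [← h.mul_one (add x one), h.mul_comm, ← h.add_neg x, ← h.add_mul, h.mul_comm (neg x),
    h.add_neg, h.mul_comm, h.mul_one, h.add_neg]

theorem add_absorb (h : Huntington add mul neg zero one) (x y : α) : add x (mul x y) = x := by
  have e := h.mul_add x one y
  rw [h.mul_one, h.add_comm one y, h.add_one, h.mul_one] at e
  exact e.symm

theorem eq_of_mul_eq (h : Huntington add mul neg zero one) {x a b : α}
    (h₁ : mul x a = mul x b) (h₂ : mul (neg x) a = mul (neg x) b) : a = b := by
  rw [← h.mul_one a, ← h.mul_one b, ← h.add_neg x, h.mul_add, h.mul_add, h.mul_comm a x,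
    h.mul_comm a, h.mul_comm b x, h.mul_comm b, h₁, h₂]

theorem add_assoc (h : Huntington add mul neg zero one) (x y z : α) :
    add (add x y) z = add x (add y z) := by
  have absorb (u v : α) : mul u (add u v) = u := h.dual.add_absorb u v
  have zero_add (u : α) : add zero u = u := by rw [h.add_comm, h.add_zero]
  have neg_mul (u : α) : mul (neg u) u = zero := by rw [h.mul_comm, h.mul_neg]
  apply h.eq_of_mul_eq (x := x)
  · rw [absorb, h.mul_add, absorb, h.add_absorb]
  · rw [h.mul_add, h.mul_add, h.mul_add, h.mul_add, neg_mul, zero_add, zero_add]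

/-- The Boolean algebra determined by Huntington's postulates. -/
@[reducible]
def toBooleanAlgebra (h : Huntington add mul neg zero one) : BooleanAlgebra α :=
  letI : Max α := ⟨add⟩
  letI : Min α := ⟨mul⟩
  letI L : Lattice α := Lattice.mk' h.add_comm h.add_assoc h.mul_comm h.dual.add_assoc
    h.add_absorb h.dual.add_absorb
  { L with
    compl := neg
    top := one
    bot := zero
    le_sup_inf := fun x y z => le_of_eq (h.add_mul x y z).symm
    inf_compl_le_bot := fun x => le_of_eq (h.mul_neg x)
    top_le_sup_compl := fun x => le_of_eq (h.add_neg x).symm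
    le_top := fun x => h.add_one x
    bot_le := fun x => (h.add_comm _ _).trans (h.add_zero x) }

end Huntington

/-- The cylindric laws (C1)-(C7) for operations on a Boolean algebra. -/
structure CylindricLaws {κ B : Type*} [BooleanAlgebra B] (c : κ → B → B) (d : κ → κ → B) :
    Prop where
  cyl_bot : ∀ i, c i ⊥ = ⊥
  le_cyl : ∀ i x, x ≤ c i x
  cyl_inf_cyl : ∀ i x y, c i (x ⊓ c i y) = c i x ⊓ c i y
  cyl_comm : ∀ i j x, c i (c j x) = c j (c i x)
  diag_self : ∀ i, d i i = ⊤
  diag_eq : ∀ i j k, i ≠ j → i ≠ k → d j k = c i (d j i ⊓ d i k)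
  cyl_diag_inf_compl : ∀ i j x, i ≠ j → c i (d i j ⊓ x) ⊓ c i (d i j ⊓ xᶜ) = ⊥

namespace CylindricLaws

section General

variable {κ B : Type*} [BooleanAlgebra B] {c : κ → B → B} {d : κ → κ → B}

theorem cyl_top (h : CylindricLaws c d) (i : κ) : c i ⊤ = ⊤ := top_le_iff.1 (h.le_cyl i ⊤)

theorem cyl_cyl (h : CylindricLaws c d) (i : κ) (x : B) : c i (c i x) = c i x := by
  simpa [h.cyl_top] using h.cyl_inf_cyl i ⊤ x

theorem cyl_mono (h : CylindricLaws c d) (i : κ) {x y : B} (hxy : x ≤ y) : c i x ≤ c i y := by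
  have e := h.cyl_inf_cyl i x y
  rw [inf_eq_left.2 (hxy.trans (h.le_cyl i y))] at e
  exact inf_eq_left.1 e.symm

theorem cyl_inf_of_closed (h : CylindricLaws c d) {i : κ} (x : B) {y : B} (hy : c i y = y) :
    c i (x ⊓ y) = c i x ⊓ y := by
  have e := h.cyl_inf_cyl i x y
  rwa [hy] at e

theorem closed_inf_cyl (h : CylindricLaws c d) {i : κ} {x : B} (y : B) (hx : c i x = x) :
    c i (x ⊓ y) = x ⊓ c i y := by
  rw [inf_comm, h.cyl_inf_of_closed y hx, inf_comm]

theorem closed_inf (h : CylindricLaws c d) {i : κ} {x y : B} (hx : c i x = x) (hy : c i y = y) :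
    c i (x ⊓ y) = x ⊓ y := by
  rw [h.cyl_inf_of_closed x hy, hx]

theorem closed_compl (h : CylindricLaws c d) {i : κ} {x : B} (hx : c i x = x) :
    c i xᶜ = xᶜ := by
  refine le_antisymm ?_ (h.le_cyl i _)
  have e := h.cyl_inf_of_closed xᶜ hx
  rw [compl_inf_eq_bot, h.cyl_bot] at e
  exact le_compl_iff_disjoint_right.2 (disjoint_iff.2 e.symm)

theorem closed_sup (h : CylindricLaws c d) {i : κ} {x y : B} (hx : c i x = x) (hy : c i y = y) :
    c i (x ⊔ y) = x ⊔ y := by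
  have e := h.closed_compl (h.closed_inf (h.closed_compl hx) (h.closed_compl hy))
  simpa using e

theorem cyl_sup (h : CylindricLaws c d) (i : κ) (x y : B) : c i (x ⊔ y) = c i x ⊔ c i y := by
  apply le_antisymm
  · rw [← h.closed_sup (h.cyl_cyl i x) (h.cyl_cyl i y)]
    exact h.cyl_mono i (sup_le_sup (h.le_cyl i x) (h.le_cyl i y))
  · exact sup_le (h.cyl_mono i le_sup_left) (h.cyl_mono i le_sup_right)

theorem cyl_diag_left (h : CylindricLaws c d) {i k : κ} (hik : i ≠ k) : c i (d i k) = ⊤ := by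
  have e := h.diag_eq i k k hik hik
  rw [h.diag_self] at e
  rw [eq_top_iff, e]
  exact h.cyl_mono i inf_le_right

theorem cyl_diag_right (h : CylindricLaws c d) {i k : κ} (hik : i ≠ k) : c i (d k i) = ⊤ := by
  have e := h.diag_eq i k k hik hik
  rw [h.diag_self] at e
  rw [eq_top_iff, e]
  exact h.cyl_mono i inf_le_left

theorem cyl_diag_of_ne (h : CylindricLaws c d) {i j k : κ} (hij : i ≠ j) (hik : i ≠ k) :
    c i (d j k) = d j k := by
  rw [h.diag_eq i j k hij hik, h.cyl_cyl]

theorem diag_trans (h : CylindricLaws c d) (j i k : κ) : d j i ⊓ d i k ≤ d j k := by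
  by_cases hij : i = j
  · subst hij; exact inf_le_right
  by_cases hik : i = k
  · subst hik; exact inf_le_left
  rw [h.diag_eq i j k hij hik]
  exact h.le_cyl i _

theorem diag_le_symm (h : CylindricLaws c d) (i k : κ) : d i k ≤ d k i := by
  by_cases hik : i = k
  · subst hik; exact le_rfl
  have e := h.cyl_diag_inf_compl i k (d k i) hik
  have e₂ : c i (d i k ⊓ d k i) = ⊤ := by
    rw [inf_comm, ← h.diag_eq i k k hik hik, h.diag_self]
  rw [e₂, top_inf_eq] at e
  have : d i k ⊓ (d k i)ᶜ ≤ ⊥ := (h.le_cyl i _).trans e.le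
  exact compl_compl (d k i) ▸ le_compl_iff_disjoint_right.2 (disjoint_iff_inf_le.2 this)

theorem diag_symm (h : CylindricLaws c d) (i k : κ) : d i k = d k i :=
  le_antisymm (h.diag_le_symm i k) (h.diag_le_symm k i)

end General

end CylindricLaws

/-- The substitution of the index `k` for the index `i`. -/
def substOne {κ B : Type*} [BooleanAlgebra B] (c : κ → B → B) (d : κ → κ → B) (i k : κ) (x : B) :
    B :=
  c i (d i k ⊓ x)

namespace CylindricLaws

section SubstOne

variable {κ B : Type*} [BooleanAlgebra B] {c : κ → B → B} {d : κ → κ → B} {i j k n : κ}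

theorem substOne_mono (h : CylindricLaws c d) {x y : B} (hxy : x ≤ y) :
    substOne c d i k x ≤ substOne c d i k y :=
  h.cyl_mono i (inf_le_inf_left _ hxy)

theorem substOne_le_cyl (h : CylindricLaws c d) (x : B) : substOne c d i k x ≤ c i x :=
  h.cyl_mono i inf_le_right

theorem substOne_sup (h : CylindricLaws c d) (x y : B) :
    substOne c d i k (x ⊔ y) = substOne c d i k x ⊔ substOne c d i k y := by
  rw [substOne, inf_sup_left, h.cyl_sup]; rfl

theorem substOne_compl (h : CylindricLaws c d) (hik : i ≠ k) (x : B) :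
    substOne c d i k xᶜ = (substOne c d i k x)ᶜ := by
  refine (IsCompl.compl_eq ⟨disjoint_iff.2 (h.cyl_diag_inf_compl i k x hik), ?_⟩).symm
  rw [codisjoint_iff]
  change substOne c d i k x ⊔ substOne c d i k xᶜ = ⊤
  rw [← h.substOne_sup, sup_compl_eq_top, substOne, inf_top_eq, h.cyl_diag_left hik]

theorem substOne_of_closed (h : CylindricLaws c d) (hik : i ≠ k) {x : B} (hx : c i x = x) :
    substOne c d i k x = x := by
  rw [substOne, h.cyl_inf_of_closed _ hx, h.cyl_diag_left hik, top_inf_eq]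

theorem cyl_substOne (h : CylindricLaws c d) (hji : j ≠ i) (hjk : j ≠ k) (x : B) :
    c j (substOne c d i k x) = substOne c d i k (c j x) := by
  rw [substOne, substOne, h.cyl_comm, h.closed_inf_cyl _ (h.cyl_diag_of_ne hji hjk)]

theorem cyl_substOne_self (h : CylindricLaws c d) (hik : i ≠ k) {x : B} (hx : c k x = x) :
    c k (substOne c d i k x) = c i x := by
  rw [substOne, h.cyl_comm, h.cyl_inf_of_closed _ hx, h.cyl_diag_right hik.symm, top_inf_eq]

theorem substOne_substOne_comm (h : CylindricLaws c d) (hij : i ≠ j) (hin : i ≠ n) (hjk : j ≠ k)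
    (x : B) :
    substOne c d i k (substOne c d j n x) = substOne c d j n (substOne c d i k x) := by
  simp only [substOne]
  rw [← h.closed_inf_cyl _ (h.cyl_diag_of_ne hij.symm hjk),
    ← h.closed_inf_cyl _ (h.cyl_diag_of_ne hij hin), h.cyl_comm, inf_left_comm]

theorem substOne_inf_diag_le (h : CylindricLaws c d) (hik : i ≠ k) (hin : i ≠ n) (x : B) :
    substOne c d i k x ⊓ d k n ≤ substOne c d i n x := by
  rw [substOne, ← h.cyl_inf_of_closed _ (h.cyl_diag_of_ne hik hin)]
  refine h.cyl_mono i (le_inf ?_ (inf_le_left.trans inf_le_right))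
  exact (inf_le_inf_right _ inf_le_left).trans (h.diag_trans i k n)

theorem substOne_diag (h : CylindricLaws c d) (hij : i ≠ j) (hik : i ≠ k) :
    substOne c d i k (d i j) = d k j := by
  rw [substOne, h.diag_symm i k, ← h.diag_eq i k j hik hij]

end SubstOne

end CylindricLaws

open Sum in
/-- The simultaneous substitution of the spare indices `τ i` for the indices `i` in a list. -/
def substList {ι B : Type*} [BooleanAlgebra B] (c : ι ⊕ ℕ → B → B) (d : ι ⊕ ℕ → ι ⊕ ℕ → B) :
    List ι → (ι → ℕ) → B → B
  | [], _, x => x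
  | i :: l, τ, x => substList c d l τ (substOne c d (inl i) (inr (τ i)) x)

/-- An element is neat if it is fixed by all cylindrifications with spare indices. -/
def IsNeat {ι B : Type*} (c : ι ⊕ ℕ → B → B) (x : B) : Prop := ∀ m, c (Sum.inr m) x = x

namespace CylindricLaws

open Sum

section SubstList

variable {ι B : Type*} [BooleanAlgebra B] {c : ι ⊕ ℕ → B → B} {d : ι ⊕ ℕ → ι ⊕ ℕ → B}

theorem substList_congr (l : List ι) {τ τ' : ι → ℕ} (hτ : ∀ j ∈ l, τ j = τ' j) (x : B) :
    substList c d l τ x = substList c d l τ' x := by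
  induction l generalizing x with
  | nil => rfl
  | cons i l ih =>
    rw [substList, substList, hτ i (by simp)]
    exact ih (fun j hj => hτ j (by simp [hj])) _

theorem substList_mono (h : CylindricLaws c d) (l : List ι) (τ : ι → ℕ) {x y : B} (hxy : x ≤ y) :
    substList c d l τ x ≤ substList c d l τ y := by
  induction l generalizing x y with
  | nil => exact hxy
  | cons i l ih => exact ih (h.substOne_mono hxy)

theorem substList_sup (h : CylindricLaws c d) (l : List ι) (τ : ι → ℕ) (x y : B) :
    substList c d l τ (x ⊔ y) = substList c d l τ x ⊔ substList c d l τ y := by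
  induction l generalizing x y with
  | nil => rfl
  | cons i l ih => simp only [substList, h.substOne_sup, ih]

theorem substList_compl (h : CylindricLaws c d) (l : List ι) (τ : ι → ℕ) (x : B) :
    substList c d l τ xᶜ = (substList c d l τ x)ᶜ := by
  induction l generalizing x with
  | nil => rfl
  | cons i l ih => simp only [substList, h.substOne_compl inl_ne_inr, ih]

theorem substList_inf (h : CylindricLaws c d) (l : List ι) (τ : ι → ℕ) (x y : B) :
    substList c d l τ (x ⊓ y) = substList c d l τ x ⊓ substList c d l τ y := by
  have e := h.substList_compl l τ (xᶜ ⊔ yᶜ)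
  simpa [h.substList_sup, h.substList_compl] using e

theorem substList_of_closed (h : CylindricLaws c d) (l : List ι) (τ : ι → ℕ) {x : B}
    (hx : ∀ i, c (inl i) x = x) : substList c d l τ x = x := by
  induction l with
  | nil => rfl
  | cons i l ih => rw [substList, h.substOne_of_closed inl_ne_inr (hx i), ih]

theorem substList_diag_inr (h : CylindricLaws c d) (l : List ι) (τ : ι → ℕ) (m n : ℕ) :
    substList c d l τ (d (inr m) (inr n)) = d (inr m) (inr n) :=
  h.substList_of_closed l τ fun _ => h.cyl_diag_of_ne inl_ne_inr inl_ne_inr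

theorem cyl_substList (h : CylindricLaws c d) (l : List ι) (τ : ι → ℕ) {m : ℕ}
    (hm : ∀ j ∈ l, τ j ≠ m) (x : B) :
    c (inr m) (substList c d l τ x) = substList c d l τ (c (inr m) x) := by
  induction l generalizing x with
  | nil => rfl
  | cons i l ih =>
    have hmi : (inr m : ι ⊕ ℕ) ≠ inr (τ i) := fun e => hm i (by simp) (inr_injective e).symm
    rw [substList, ih (fun j hj => hm j (by simp [hj])), h.cyl_substOne inr_ne_inl hmi]
    rfl

theorem substList_perm (h : CylindricLaws c d) {l l' : List ι} (hl : l.Perm l') (τ : ι → ℕ)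
    (x : B) : substList c d l τ x = substList c d l' τ x := by
  induction hl generalizing x with
  | nil => rfl
  | cons i _ ih => exact ih _
  | swap i j l =>
    simp only [substList]
    by_cases hij : i = j
    · rw [hij]
    · rw [h.substOne_substOne_comm (fun e => hij (inl_injective e)) inl_ne_inr inl_ne_inr]
  | trans _ _ ih₁ ih₂ => rw [ih₁, ih₂]

theorem exists_substList_eq (h : CylindricLaws c d) {l : List ι} (hl : l.Nodup) {i : ι}
    (hi : i ∈ l) : ∃ l' : List ι, l'.Nodup ∧ i ∉ l' ∧ (∀ j, j ∈ l ↔ j = i ∨ j ∈ l') ∧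
      ∀ τ x, substList c d l τ x = substList c d l' τ (substOne c d (inl i) (inr (τ i)) x) := by
  classical
  have hp := List.perm_cons_erase hi
  have hn := (hp.nodup_iff.1 hl)
  rw [List.nodup_cons] at hn
  exact ⟨l.erase i, hn.2, hn.1, fun j => by rw [hp.mem_iff, List.mem_cons],
    fun τ x => h.substList_perm hp τ x⟩

theorem substList_le_substList_cyl (h : CylindricLaws c d) {l : List ι} (hl : l.Nodup) {i : ι}
    (hi : i ∈ l) {τ τ' : ι → ℕ} (hτ : ∀ j, j ≠ i → τ j = τ' j) (x : B) :
    substList c d l τ x ≤ substList c d l τ' (c (inl i) x) := by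
  obtain ⟨l', -, hil, -, hs⟩ := h.exists_substList_eq hl hi
  rw [hs, hs, h.substOne_of_closed inl_ne_inr (h.cyl_cyl _ _),
    substList_congr l' (τ := τ) (τ' := τ') fun j hj => hτ j (ne_of_mem_of_not_mem hj hil)]
  exact h.substList_mono l' τ' (h.substOne_le_cyl x)

theorem substList_inf_diag_le (h : CylindricLaws c d) {l : List ι} (hl : l.Nodup) {i : ι}
    (hi : i ∈ l) {τ τ' : ι → ℕ} (hτ : ∀ j, j ≠ i → τ j = τ' j) (x : B) :
    substList c d l τ x ⊓ d (inr (τ i)) (inr (τ' i)) ≤ substList c d l τ' x := by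
  obtain ⟨l', -, hil, -, hs⟩ := h.exists_substList_eq hl hi
  rw [hs, hs, substList_congr l' (τ := τ) (τ' := τ') fun j hj =>
    hτ j (ne_of_mem_of_not_mem hj hil), ← h.substList_diag_inr l' τ', ← h.substList_inf]
  exact h.substList_mono l' τ' (h.substOne_inf_diag_le inl_ne_inr inl_ne_inr x)

theorem cyl_substList_self (h : CylindricLaws c d) {l : List ι} (hl : l.Nodup) {i : ι}
    (hi : i ∈ l) {τ τ' : ι → ℕ} (hτ : ∀ j, j ≠ i → τ j = τ' j) (hm : ∀ j ∈ l, τ' j ≠ τ i)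
    {x : B} (hx : c (inr (τ i)) x = x) :
    c (inr (τ i)) (substList c d l τ x) = substList c d l τ' (c (inl i) x) := by
  obtain ⟨l', -, hil, hmem, hs⟩ := h.exists_substList_eq hl hi
  rw [hs, hs, h.substOne_of_closed inl_ne_inr (h.cyl_cyl _ _),
    substList_congr l' (τ := τ) (τ' := τ') fun j hj => hτ j (ne_of_mem_of_not_mem hj hil),
    h.cyl_substList l' τ' fun j hj => hm j ((hmem j).2 (Or.inr hj)),
    h.cyl_substOne_self inl_ne_inr hx]

theorem substList_diag (h : CylindricLaws c d) {l : List ι} (hl : l.Nodup) {i j : ι}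
    (hi : i ∈ l) (hj : j ∈ l) (τ : ι → ℕ) :
    substList c d l τ (d (inl i) (inl j)) = d (inr (τ i)) (inr (τ j)) := by
  by_cases hij : i = j
  · subst hij
    rw [h.diag_self, h.diag_self, ← h.diag_self (inr 0), h.substList_diag_inr]
  obtain ⟨l', hl', hil, hmem, hs⟩ := h.exists_substList_eq hl hi
  obtain ⟨l'', -, -, -, hs'⟩ :=
    h.exists_substList_eq hl' (((hmem j).1 hj).resolve_left (Ne.symm hij))
  rw [hs, h.substOne_diag (fun e => hij (inl_injective e)) inl_ne_inr, hs', h.diag_symm,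
    h.substOne_diag inl_ne_inr inl_ne_inr, h.substList_diag_inr, h.diag_symm]

theorem substList_ne_bot (h : CylindricLaws c d) {l : List ι} (hl : l.Nodup) {τ : ι → ℕ}
    (hτ : ∀ i ∈ l, ∀ j ∈ l, τ i = τ j → i = j) {x : B} (hx : ∀ i ∈ l, c (inr (τ i)) x = x)
    (hx₀ : x ≠ ⊥) : substList c d l τ x ≠ ⊥ := by
  induction l generalizing x with
  | nil => exact hx₀
  | cons i l ih =>
    rw [List.nodup_cons] at hl
    refine ih hl.2 (fun i hi j hj => hτ i (by simp [hi]) j (by simp [hj])) (fun j hj => ?_) ?_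
    · have hji : (inr (τ j) : ι ⊕ ℕ) ≠ inr (τ i) := fun e =>
        hl.1 (hτ j (by simp [hj]) i (by simp) (inr_injective e) ▸ hj)
      rw [h.cyl_substOne inr_ne_inl hji, hx j (by simp [hj])]
    · intro e
      have e' := h.cyl_substOne_self (i := inl i) inl_ne_inr (hx i (by simp))
      rw [e, h.cyl_bot] at e'
      exact hx₀ (le_bot_iff.1 (e' ▸ h.le_cyl _ x))

end SubstList

end CylindricLaws

open Order in
/-- A Rasiowa-Sikorski lemma: countably many existential witnesses can be found for an
ultrafilter, here given as the complement of a prime ideal. -/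
theorem exists_prime_ideal_with_witnesses {B Q : Type*} [BooleanAlgebra B] [Countable Q]
    (Good : B → Prop) (hGood : ∀ b, Good b → b ≠ ⊥) (y : Q → B) (g : Q → ℕ → B)
    (hstep : ∀ q b, Good b → ∃ m, Good (b ⊓ ((y q)ᶜ ⊔ g q m))) {b₀ : B} (hb₀ : Good b₀) :
    ∃ J : Order.Ideal B, J.IsPrime ∧ b₀ ∉ J ∧ ∀ q, y q ∉ J → ∃ m, g q m ∉ J := by
  have := Encodable.ofCountable Q
  let 𝒟 : Q → Cofinal {b : B // Good b}ᵒᵈ := fun q =>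
    { carrier := {p | ∃ m, (OrderDual.ofDual p).1 ≤ (y q)ᶜ ⊔ g q m}
      isCofinal := fun p => by
        obtain ⟨m, hm⟩ := hstep q (OrderDual.ofDual p).1 (OrderDual.ofDual p).2
        exact ⟨OrderDual.toDual ⟨_, hm⟩, ⟨m, inf_le_right⟩,
          OrderDual.ofDual_le_ofDual.1 (Subtype.mk_le_mk.2 inf_le_left)⟩ }
  let p₀ : {b : B // Good b}ᵒᵈ := OrderDual.toDual ⟨b₀, hb₀⟩
  let I := idealOfCofinals p₀ 𝒟
  have hF : IsPFilter {b : B | ∃ p ∈ I, (OrderDual.ofDual p).1 ≤ b} := by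
    refine IsPFilter.of_def ⟨b₀, p₀, mem_idealOfCofinals p₀ 𝒟, le_rfl⟩ ?_ ?_
    · rintro x ⟨p, hp, hpx⟩ y ⟨q, hq, hqy⟩
      obtain ⟨r, hr, hpr, hqr⟩ := I.directed p hp q hq
      exact ⟨(OrderDual.ofDual r).1, ⟨r, hr, le_rfl⟩,
        le_trans (OrderDual.ofDual_le_ofDual.2 hpr) hpx,
        le_trans (OrderDual.ofDual_le_ofDual.2 hqr) hqy⟩
    · rintro x y hxy ⟨p, hp, hpx⟩
      exact ⟨p, hp, hpx.trans hxy⟩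
  obtain ⟨J, hJ, -, hdisj⟩ := DistribLattice.prime_ideal_of_disjoint_filter_ideal
    (F := hF.toPFilter) (I := Order.Ideal.principal (⊥ : B)) <| by
      rw [Set.disjoint_left]
      rintro x ⟨p, -, hpx⟩ hx
      exact hGood _ (OrderDual.ofDual p).2 (le_bot_iff.1 (hpx.trans hx))
  have hmem : ∀ p ∈ I, ∀ b, (OrderDual.ofDual p).1 ≤ b → b ∉ J := fun p hp b hb hbJ =>
    Set.disjoint_left.1 hdisj (show b ∈ hF.toPFilter from ⟨p, hp, hb⟩) hbJ
  refine ⟨J, hJ, hmem p₀ (mem_idealOfCofinals p₀ 𝒟) b₀ le_rfl, fun q hq => ?_⟩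
  obtain ⟨p, ⟨m, hm⟩, hp⟩ := cofinal_meets_idealOfCofinals p₀ 𝒟 q
  refine ⟨m, fun hg => hmem p hp _ hm (Order.Ideal.sup_mem ?_ hg)⟩
  exact (hJ.mem_or_compl_mem (x := y q)).resolve_left hq

namespace Order.Ideal.IsPrime

variable {B : Type*} [BooleanAlgebra B] {J : Order.Ideal B}

theorem compl_notMem_iff (hJ : J.IsPrime) (x : B) : xᶜ ∉ J ↔ ¬ x ∉ J := by
  rw [not_not]
  refine ⟨fun h => hJ.mem_or_compl_mem.resolve_right h, fun hx hx' => hJ.toIsProper.top_notMem ?_⟩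
  have := J.sup_mem hx hx'
  rwa [sup_compl_eq_top] at this

theorem inf_notMem_iff (hJ : J.IsPrime) (x y : B) : x ⊓ y ∉ J ↔ x ∉ J ∧ y ∉ J := by
  rw [← not_or, not_iff_not]
  exact ⟨hJ.mem_or_mem, fun h => h.elim (J.lower inf_le_left) (J.lower inf_le_right)⟩

end Order.Ideal.IsPrime

namespace CylindricLaws

open Sum

section Witness

variable {ι B : Type*} [BooleanAlgebra B] {c : ι ⊕ ℕ → B → B} {d : ι ⊕ ℕ → ι ⊕ ℕ → B}

theorem finite_not_closed_substList (h : CylindricLaws c d) (l : List ι) (τ : ι → ℕ) {x : B}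
    (hx : IsNeat c x) : {m | c (inr m) (substList c d l τ x) ≠ substList c d l τ x}.Finite := by
  refine ((l.map τ).finite_toSet).subset fun m hm => ?_
  by_contra hml
  refine hm ?_
  rw [h.cyl_substList l τ (fun j hj e => hml (List.mem_map.2 ⟨j, hj, e⟩)), hx m]

theorem isNeat_cyl (h : CylindricLaws c d) {x : B} (hx : IsNeat c x) (i : ι ⊕ ℕ) :
    IsNeat c (c i x) := fun m => by rw [h.cyl_comm, hx m]

theorem exists_witness (h : CylindricLaws c d) [DecidableEq ι] {l : List ι} (hl : l.Nodup) {i : ι}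
    (hi : i ∈ l) (τ : ι → ℕ) {x : B} (hx : IsNeat c x) {b : B}
    (hb : b ≠ ⊥ ∧ {m | c (inr m) b ≠ b}.Finite) :
    ∃ m, b ⊓ ((substList c d l τ (c (inl i) x))ᶜ ⊔ substList c d l (Function.update τ i m) x) ≠ ⊥ ∧
      {n | c (inr n)
        (b ⊓ ((substList c d l τ (c (inl i) x))ᶜ ⊔ substList c d l (Function.update τ i m) x)) ≠
        b ⊓ ((substList c d l τ (c (inl i) x))ᶜ ⊔
          substList c d l (Function.update τ i m) x)}.Finite := by
  obtain ⟨m, hm⟩ := (hb.2.union (l.map τ).finite_toSet).exists_notMem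
  simp only [Set.mem_union, Set.mem_ofPred_eq, not_or, not_not] at hm
  have hm₂ : ∀ j ∈ l, τ j ≠ m := fun j hj e => hm.2 (List.mem_map.2 ⟨j, hj, e⟩)
  refine ⟨m, fun e => hb.1 ?_, ?_⟩
  · have hz := h.cyl_substList_self (τ := Function.update τ i m) (τ' := τ) hl hi
      (fun j hj => Function.update_of_ne hj _ _) (by simpa using hm₂) (x := x) (hx _)
    rw [Function.update_self] at hz
    have hy : c (inr m) (substList c d l τ (c (inl i) x)) = substList c d l τ (c (inl i) x) := by
      rw [← hz, h.cyl_cyl]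
    have e' := h.closed_inf_cyl ((substList c d l τ (c (inl i) x))ᶜ ⊔
      substList c d l (Function.update τ i m) x) hm.1
    rw [e, h.cyl_bot, h.cyl_sup, hz, h.closed_compl hy, compl_sup_eq_top, inf_top_eq] at e'
    exact e'.symm
  · refine ((hb.2.union (h.finite_not_closed_substList l τ (h.isNeat_cyl hx (inl i)))).union
      (h.finite_not_closed_substList l (Function.update τ i m) hx)).subset fun n hn => ?_
    by_contra hn'
    simp only [Set.mem_union, Set.mem_ofPred_eq, not_or, not_not] at hn'
    exact hn (h.closed_inf hn'.1.1 (h.closed_sup (h.closed_compl hn'.1.2) hn'.2))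

theorem exists_henkin_ideal (h : CylindricLaws c d) [DecidableEq ι] {l : List ι} (hl : l.Nodup)
    {S : Set B} (hS : S.Countable) {b : B} (hb : IsNeat c b) (hb₀ : b ≠ ⊥) {τ₀ : ι → ℕ}
    (hτ₀ : ∀ i ∈ l, ∀ j ∈ l, τ₀ i = τ₀ j → i = j) :
    ∃ J : Order.Ideal B, J.IsPrime ∧ substList c d l τ₀ b ∉ J ∧
      ∀ x ∈ S, IsNeat c x → ∀ i ∈ l, ∀ τ : ι → ℕ, substList c d l τ (c (inl i) x) ∉ J →
        ∃ m, substList c d l (Function.update τ i m) x ∉ J := by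
  have : Countable S := hS
  have : Finite {i // i ∈ l} := l.finite_toSet
  let extend : ({i // i ∈ l} → ℕ) → ι → ℕ := fun τ i => if hi : i ∈ l then τ ⟨i, hi⟩ else 0
  let Q := {x : S // IsNeat c x.1} × {i // i ∈ l} × ({i // i ∈ l} → ℕ)
  obtain ⟨J, hJ, hbJ, hw⟩ := exists_prime_ideal_with_witnesses (Q := Q)
    (fun b => b ≠ ⊥ ∧ {m | c (inr m) b ≠ b}.Finite) (fun _ h => h.1)
    (fun q => substList c d l (extend q.2.2) (c (inl q.2.1.1) q.1.1.1))
    (fun q m => substList c d l (Function.update (extend q.2.2) q.2.1.1 m) q.1.1.1)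
    (fun q b hb => h.exists_witness hl q.2.1.2 _ q.1.2 hb)
    (b₀ := substList c d l τ₀ b)
    ⟨h.substList_ne_bot hl hτ₀ (fun _ _ => hb _) hb₀, h.finite_not_closed_substList l τ₀ hb⟩
  refine ⟨J, hJ, hbJ, fun x hx hxn i hi τ hτ => ?_⟩
  have hext : ∀ j ∈ l, extend (fun j => τ j.1) j = τ j := fun j hj => dif_pos hj
  obtain ⟨m, hm⟩ := hw ⟨⟨⟨x, hx⟩, hxn⟩, ⟨i, hi⟩, fun j => τ j.1⟩
    (by rwa [substList_congr l hext])
  refine ⟨m, ?_⟩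
  rwa [substList_congr l (τ' := Function.update τ i m)] at hm
  intro j hj
  by_cases hji : j = i
  · subst hji; simp
  · simp only [Function.update_of_ne hji]; exact hext j hj

end Witness

end CylindricLaws

theorem mem_cylSet_iff {ι U : Type*} [DecidableEq ι] {i : ι} {X : Set (ι → U)} {s : ι → U} :
    s ∈ cylSet ι U i X ↔ ∃ u, Function.update s i u ∈ X := by
  constructor
  · rintro ⟨t, ht, hts⟩
    refine ⟨t i, ?_⟩
    rwa [← Function.eq_update_iff.2 ⟨rfl, hts⟩]
  · rintro ⟨u, hu⟩
    exact ⟨_, hu, fun j hj => Function.update_of_ne hj _ _⟩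

theorem cylSet_comm {ι U : Type*} (i j : ι) (X : Set (ι → U)) :
    cylSet ι U i (cylSet ι U j X) = cylSet ι U j (cylSet ι U i X) := by
  classical
  by_cases hij : i = j
  · rw [hij]
  ext s
  simp only [mem_cylSet_iff]
  rw [exists_comm]
  simp only [Function.update_comm hij]

namespace CylindricLaws

open Sum Filter

/-- Every nonzero neat element is nonzero in some representation by sets of sequences that
respects cylindrifications of neat elements. -/
theorem exists_representation {ι B : Type u} [BooleanAlgebra B] {c : ι ⊕ ℕ → B → B}
    {d : ι ⊕ ℕ → ι ⊕ ℕ → B} (h : CylindricLaws c d) {b : B} (hb : IsNeat c b) (hb₀ : b ≠ ⊥) :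
    ∃ (U : Type u) (r : B → Set (ι → U)), (r b).Nonempty ∧
      (∀ x y, r (x ⊓ y) = r x ∩ r y) ∧ (∀ x, r xᶜ = (r x)ᶜ) ∧
      (∀ i x, IsNeat c x → r (c (inl i) x) = cylSet ι U i (r x)) ∧
      ∀ i j, r (d (inl i) (inl j)) = diagSet ι U i j := by
  classical
  let P := Finset ι × Finset B
  have hτ (p : P) : ∃ τ : ι → ℕ, ∀ i ∈ p.1.toList, ∀ j ∈ p.1.toList, τ i = τ j → i = j := by
    obtain ⟨τ, hτ⟩ := Set.countable_iff_exists_injOn.1 p.1.countable_toSet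
    exact ⟨τ, fun i hi j hj => hτ (by simpa using hi) (by simpa using hj)⟩
  choose τ₀ hτ₀ using hτ
  choose J hJ hbJ hw using fun p : P =>
    h.exists_henkin_ideal p.1.nodup_toList p.2.countable_toSet hb hb₀ (hτ₀ p)
  let 𝓕 : Ultrafilter P := Ultrafilter.of atTop
  have hfst (i : ι) : ∀ᶠ p in (𝓕 : Filter P), i ∈ p.1.toList :=
    Ultrafilter.of_le _ <| (eventually_ge_atTop (({i}, ∅) : P)).mono fun p hp => by
      simpa using hp.1
  have hsnd (x : B) : ∀ᶠ p in (𝓕 : Filter P), x ∈ p.2 :=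
    Ultrafilter.of_le _ <| (eventually_ge_atTop ((∅, {x}) : P)).mono fun p hp => by
      simpa using hp.2
  let E : Setoid (P → ℕ) :=
    { r := fun f g => ∀ᶠ p in (𝓕 : Filter P), d (inr (f p)) (inr (g p)) ∉ J p
      iseqv :=
        { refl := fun f => .of_forall fun p => by
            rw [h.diag_self]; exact (hJ p).toIsProper.top_notMem
          symm := fun hfg => hfg.mono fun p hp => by rwa [h.diag_symm]
          trans := fun hfg hgk => (hfg.and hgk).mono fun p hp hmem =>
            ((hJ p).inf_notMem_iff _ _).2 hp ((J p).lower (h.diag_trans _ _ _) hmem) } }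
  let rep : ι → Quotient E → P → ℕ := fun i u =>
    if u = Quotient.mk E (fun p => τ₀ p i) then fun p => τ₀ p i else u.out
  have hrep (i : ι) (u : Quotient E) : Quotient.mk E (rep i u) = u := by
    by_cases hu : u = Quotient.mk E (fun p => τ₀ p i)
    · simp only [rep, hu, if_true]
    · simp only [rep, if_neg hu, Quotient.out_eq]
  let r : B → Set (ι → Quotient E) := fun x =>
    {s | ∀ᶠ p in (𝓕 : Filter P), substList c d p.1.toList (fun i => rep i (s i) p) x ∉ J p}
  refine ⟨Quotient E, r, ⟨fun i => Quotient.mk E (fun p => τ₀ p i), ?_⟩, fun x y => ?_,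
    fun x => ?_, fun i x hx => ?_, fun i j => ?_⟩
  · refine .of_forall fun p => ?_
    simpa [rep] using hbJ p
  · ext s
    simp only [r, Set.mem_inter_iff, Set.mem_ofPred_eq, h.substList_inf, ← eventually_and]
    exact eventually_congr (.of_forall fun p => (hJ p).inf_notMem_iff _ _)
  · ext s
    simp only [r, Set.mem_compl_iff, Set.mem_ofPred_eq, h.substList_compl,
      ← Ultrafilter.eventually_not]
    exact eventually_congr (.of_forall fun p => (hJ p).compl_notMem_iff _)
  · ext s
    rw [mem_cylSet_iff]
    have hoff (u : Quotient E) (p : P) (j : ι) (hj : j ≠ i) :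
        rep j (Function.update s i u j) p = rep j (s j) p := by
      rw [Function.update_of_ne hj]
    constructor
    · intro hs
      have hex : ∀ᶠ p in (𝓕 : Filter P), ∃ m, substList c d p.1.toList
          (Function.update (fun i => rep i (s i) p) i m) x ∉ J p := by
        filter_upwards [hs, hfst i, hsnd x] with p hp hi hxp
        exact hw p x hxp hx i hi _ hp
      obtain ⟨g, hg⟩ := hex.choice
      refine ⟨Quotient.mk E g, ?_⟩
      have hgu : ∀ᶠ p in (𝓕 : Filter P), d (inr (g p)) (inr (rep i (Quotient.mk E g) p)) ∉ J p :=
        Quotient.exact (hrep i (Quotient.mk E g)).symm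
      filter_upwards [hg, hgu, hfst i] with p hgp hup hi hmem
      refine ((hJ p).inf_notMem_iff _ _).2 ⟨hgp, hup⟩ ((J p).lower ?_ hmem)
      have := h.substList_inf_diag_le p.1.nodup_toList hi
        (τ := Function.update (fun i => rep i (s i) p) i (g p))
        (τ' := fun j => rep j (Function.update s i (Quotient.mk E g) j) p)
        (fun j hj => by rw [hoff _ _ _ hj, Function.update_of_ne hj]) x
      simpa only [Function.update_self] using this
    · rintro ⟨u, hu⟩
      filter_upwards [hu, hfst i] with p hp hi hmem
      exact hp ((J p).lower
        (h.substList_le_substList_cyl p.1.nodup_toList hi (hoff u p) x) hmem)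
  · ext s
    have : s i = s j ↔ ∀ᶠ p in (𝓕 : Filter P), d (inr (rep i (s i) p)) (inr (rep j (s j) p)) ∉ J p := by
      conv_lhs => rw [← hrep i (s i), ← hrep j (s j)]
      exact Quotient.eq
    refine Iff.trans (eventually_congr ?_) this.symm
    filter_upwards [hfst i, hfst j] with p hi hj
    rw [h.substList_diag p.1.nodup_toList hi hj]

end CylindricLaws

namespace RawCA

theorem IsBoolean.huntington {ι : Type v} {M : RawCA.{u, v} ι} (h : M.IsBoolean) :
    Huntington M.add M.mul M.neg M.zero M.one :=
  ⟨h.1, h.2.1, h.2.2.1, h.2.2.2.1, h.2.2.2.2.1, h.2.2.2.2.2.1, h.2.2.2.2.2.2.1, h.2.2.2.2.2.2.2⟩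

theorem IsCA.cylindricLaws {ι : Type v} {M : RawCA.{u, v} ι} (h : M.IsCA) :
    letI := h.1.huntington.toBooleanAlgebra
    CylindricLaws M.c M.d :=
  letI := h.1.huntington.toBooleanAlgebra
  ⟨h.2.1, h.2.2.1, h.2.2.2.1, h.2.2.2.2.1, h.2.2.2.2.2.1, h.2.2.2.2.2.2.1, h.2.2.2.2.2.2.2⟩

theorem isCA_prodAlg {ι : Type v} {I : Type w} {F : I → RawCA.{u, v} ι} (hF : ∀ k, (F k).IsCA) :
    (prodAlg F).IsCA := by
  refine ⟨⟨?_, ?_, ?_, ?_, ?_, ?_, ?_, ?_⟩, ?_, ?_, ?_, ?_, ?_, ?_, ?_⟩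
  · exact fun x y => funext fun k => (hF k).1.1 _ _
  · exact fun x y => funext fun k => (hF k).1.2.1 _ _
  · exact fun x y z => funext fun k => (hF k).1.2.2.1 _ _ _
  · exact fun x y z => funext fun k => (hF k).1.2.2.2.1 _ _ _
  · exact fun x => funext fun k => (hF k).1.2.2.2.2.1 _
  · exact fun x => funext fun k => (hF k).1.2.2.2.2.2.1 _
  · exact fun x => funext fun k => (hF k).1.2.2.2.2.2.2.1 _
  · exact fun x => funext fun k => (hF k).1.2.2.2.2.2.2.2 _
  · exact fun i => funext fun k => (hF k).2.1 _
  · exact fun i x => funext fun k => (hF k).2.2.1 _ _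
  · exact fun i x y => funext fun k => (hF k).2.2.2.1 _ _ _
  · exact fun i j x => funext fun k => (hF k).2.2.2.2.1 _ _ _
  · exact fun i => funext fun k => (hF k).2.2.2.2.2.1 _
  · exact fun i j l hij hil => funext fun k => (hF k).2.2.2.2.2.2.1 _ _ _ hij hil
  · exact fun i j x hij => funext fun k => (hF k).2.2.2.2.2.2.2 _ _ _ hij

theorem isCA_fullSetAlg (ι : Type v) (U : Type u) : (fullSetAlg ι U).IsCA := by
  classical
  refine ⟨⟨Set.union_comm, Set.inter_comm, Set.union_inter_distrib_left,
    Set.inter_union_distrib_left, Set.union_empty, Set.inter_univ, Set.union_compl_self,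
    Set.inter_compl_self⟩, ?_, ?_, ?_, ?_, ?_, ?_, ?_⟩
  · intro i
    refine Set.ext fun s => ?_
    exact ⟨fun ⟨t, ht, _⟩ => ht, fun hs => hs.elim⟩
  · intro i X
    exact Set.union_eq_self_of_subset_left fun s hs => ⟨s, hs, fun _ _ => rfl⟩
  · intro i X Y
    refine Set.ext fun s => ?_
    constructor
    · rintro ⟨t, ⟨htX, t', ht'Y, htt'⟩, hts⟩
      exact ⟨⟨t, htX, hts⟩, t', ht'Y, fun j hj => (htt' j hj).trans (hts j hj)⟩
    · rintro ⟨⟨t, htX, hts⟩, t', ht'Y, ht's⟩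
      exact ⟨t, ⟨htX, t', ht'Y, fun j hj => (ht's j hj).trans (hts j hj).symm⟩, hts⟩
  · exact fun i j X => cylSet_comm i j X
  · exact fun i => Set.eq_univ_of_forall fun s => rfl
  · intro i j k hij hik
    refine Set.ext fun s => ?_
    constructor
    · intro (hs : s j = s k)
      refine ⟨Function.update s i (s j), ⟨?_, ?_⟩, fun l hl => Function.update_of_ne hl _ _⟩
      · change Function.update s i (s j) j = Function.update s i (s j) i
        simp [hij.symm]
      · change Function.update s i (s j) i = Function.update s i (s j) k
        simpa [hik.symm] using hs
    · rintro ⟨t, ⟨htj, htk⟩, hts⟩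
      change s j = s k
      rw [← hts j hij.symm, ← hts k hik.symm]
      exact Eq.trans htj htk
  · intro i j X hij
    refine Set.eq_empty_of_forall_notMem ?_
    rintro s ⟨⟨t, ⟨ht, htX⟩, hts⟩, t', ⟨ht', ht'X⟩, ht's⟩
    refine ht'X ?_
    convert htX using 1
    have hj : t' j = t j := (ht's j hij.symm).trans (hts j hij.symm).symm
    funext k
    by_cases hk : k = i
    · subst hk
      exact Eq.trans ht' (hj.trans (Eq.symm ht))
    · exact (ht's k hk).trans (hts k hk).symm

open Sum in
/-- An algebra that embeds neatly into a cylindric algebra with infinitely many spare dimensions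
is representable. -/
theorem representable_of_isNeatEmbedding {ι : Type u} {A : RawCA.{u, u} ι}
    {B : RawCA.{u, u} (ι ⊕ ℕ)} (hB : B.IsCA) {f : A.carrier → B.carrier}
    (hf : IsNeatEmbedding A B Sum.inl f) : A.Representable := by
  let := hB.1.huntington.toBooleanAlgebra
  have h : CylindricLaws B.c B.d := hB.cylindricLaws
  obtain ⟨hinj, hadd, hmul, hneg, hzero, hone, hc, hd, hneat⟩ := hf
  have hfn (x : A.carrier) : IsNeat B.c (f x) := fun m => hneat x (inr m) (by simp)
  choose U r hrb hinf hcompl hcyl hdiag using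
    fun b : {b : B.carrier // IsNeat B.c b ∧ b ≠ ⊥} => h.exists_representation b.2.1 b.2.2
  have hbot (b) : r b ⊥ = ∅ := by
    rw [← inf_compl_eq_bot (a := (⊥ : B.carrier)), hinf, hcompl, Set.inter_compl_self]
  have htop (b) : r b ⊤ = Set.univ := by rw [← compl_bot, hcompl, hbot, Set.compl_empty]
  have hsup (b x y) : r b (x ⊔ y) = r b x ∪ r b y := by
    rw [← compl_compl (x ⊔ y), compl_sup, hcompl, hinf, hcompl, hcompl, Set.compl_inter,
      compl_compl, compl_compl]
  refine ⟨{b : B.carrier // IsNeat B.c b ∧ b ≠ ⊥}, U, fun x b => r b (f x), ?_, ?_⟩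
  · intro x y hxy
    by_contra hne
    have key (u v : A.carrier) (huv : ∀ b, r b (f u) = r b (f v)) : f u ≤ f v := by
      by_contra hle
      have hn : IsNeat B.c (f u ⊓ (f v)ᶜ) := fun m =>
        h.closed_inf (hfn u m) (h.closed_compl (hfn v m))
      have h₀ : f u ⊓ (f v)ᶜ ≠ ⊥ := fun e =>
        hle (by simpa using le_compl_iff_disjoint_right.2 (disjoint_iff.2 e))
      obtain ⟨s, hs⟩ := hrb ⟨_, hn, h₀⟩
      rw [hinf, hcompl, huv, Set.inter_compl_self] at hs
      exact hs
    exact hne (hinj (le_antisymm (key x y fun b => congrFun hxy b)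
      (key y x fun b => (congrFun hxy b).symm)))
  · refine ⟨fun x y => funext fun b => ?_, fun x y => funext fun b => ?_, fun x => funext fun b => ?_,
      funext fun b => ?_, funext fun b => ?_, fun i x => funext fun b => ?_,
      fun i j => funext fun b => ?_⟩
    · exact (congrArg (r b) (hadd x y)).trans (hsup b _ _)
    · exact (congrArg (r b) (hmul x y)).trans (hinf b _ _)
    · exact (congrArg (r b) (hneg x)).trans (hcompl b _)
    · exact (congrArg (r b) hzero).trans (hbot b)
    · exact (congrArg (r b) hone).trans (htop b)
    · exact (congrArg (r b) (hc i x)).trans (hcyl b i _ (hfn x))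
    · exact (congrArg (r b) (hd i j)).trans (hdiag b i j)

open Sum in
/-- A representation pulls back along surjections from sequences with spare entries that respect
updates and equality of entries, giving a neat embedding into a product of set algebras. -/
theorem exists_isNeatEmbedding_of_surjective {ι : Type u} {A : RawCA.{u, u} ι} {I : Type u}
    {U V : I → Type u} {f : A.carrier → (prodAlg fun k => fullSetAlg ι (U k)).carrier}
    (hinj : Function.Injective f) (hf : IsHom A (prodAlg fun k => fullSetAlg ι (U k)) f)
    (π : ∀ k, (ι ⊕ ℕ → V k) → ι → U k) (hπ : ∀ k, Function.Surjective (π k))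
    (hcyl : ∀ k i (X : Set (ι → U k)),
      π k ⁻¹' cylSet ι (U k) i X = cylSet (ι ⊕ ℕ) (V k) (inl i) (π k ⁻¹' X))
    (hdiag : ∀ k i j, π k ⁻¹' diagSet ι (U k) i j = diagSet (ι ⊕ ℕ) (V k) (inl i) (inl j))
    (hneat : ∀ k s t, (∀ i, s (inl i) = t (inl i)) → π k s = π k t) :
    ∃ (B : RawCA.{u, u} (ι ⊕ ℕ)) (g : A.carrier → B.carrier),
      B.IsCA ∧ IsNeatEmbedding A B Sum.inl g := by
  obtain ⟨hadd, hmul, hneg, hzero, hone, hc, hd⟩ := hf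
  refine ⟨prodAlg fun k => fullSetAlg (ι ⊕ ℕ) (V k), fun x k => π k ⁻¹' f x k,
    isCA_prodAlg fun k => isCA_fullSetAlg _ _, ?_, ?_, ?_, ?_, ?_, ?_, ?_, ?_, ?_⟩
  · exact fun x y hxy => hinj (funext fun k => (hπ k).preimage_injective (congrFun hxy k))
  · exact fun x y => funext fun k => congrArg (π k ⁻¹' ·) (congrFun (hadd x y) k)
  · exact fun x y => funext fun k => congrArg (π k ⁻¹' ·) (congrFun (hmul x y) k)
  · exact fun x => funext fun k => congrArg (π k ⁻¹' ·) (congrFun (hneg x) k)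
  · exact funext fun k => congrArg (π k ⁻¹' ·) (congrFun hzero k)
  · exact funext fun k => congrArg (π k ⁻¹' ·) (congrFun hone k)
  · exact fun i x => funext fun k =>
      (congrArg (π k ⁻¹' ·) (congrFun (hc i x) k)).trans (hcyl k i _)
  · exact fun i j => funext fun k =>
      (congrArg (π k ⁻¹' ·) (congrFun (hd i j) k)).trans (hdiag k i j)
  · intro x n hn
    funext k
    refine Set.Subset.antisymm ?_ fun s hs => ⟨s, hs, fun _ _ => rfl⟩
    rintro s ⟨t, ht, hts⟩
    change π k s ∈ (show Set (ι → U k) from f x k)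
    rw [hneat k s t fun i => (hts _ fun e => hn ⟨i, e⟩).symm]
    exact ht

open Sum in
theorem Representable.exists_isNeatEmbedding {ι : Type u} {A : RawCA.{u, u} ι}
    (hA : A.Representable) :
    ∃ (B : RawCA.{u, u} (ι ⊕ ℕ)) (g : A.carrier → B.carrier),
      B.IsCA ∧ IsNeatEmbedding A B Sum.inl g := by
  classical
  obtain ⟨I, U, f, hinj, hf⟩ := hA
  cases isEmpty_or_nonempty ι with
  | inl hι =>
    exact exists_isNeatEmbedding_of_surjective (V := fun _ => PUnit) hinj hf
      (fun _ _ => isEmptyElim) (fun k t => ⟨fun _ => PUnit.unit, Subsingleton.elim _ _⟩)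
      (fun _ i => isEmptyElim i) (fun _ i => isEmptyElim i) (fun _ _ _ _ => rfl)
  | inr hι =>
    refine exists_isNeatEmbedding_of_surjective (V := U) hinj hf (fun _ s i => s (inl i))
      (fun k t => ⟨Sum.elim t fun _ => t hι.some, rfl⟩) (fun k i X => ?_) (fun _ _ _ => rfl)
      (fun _ s t hst => funext hst)
    ext s
    rw [Set.mem_preimage, mem_cylSet_iff, mem_cylSet_iff]
    refine exists_congr fun u => ?_
    rw [Set.mem_preimage]
    refine iff_of_eq (congrArg (· ∈ X) (funext fun j => ?_))
    by_cases hj : j = i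
    · subst hj; simp
    · simp [hj]

end RawCA

/-- **Henkin's Neat Embedding Theorem.**  For every dimension (ordinal) α and
every cylindric algebra `A` of dimension α (here the dimension is an arbitrary
index type `ι`, and the ordinal α + ω is modelled by `ι ⊕ ℕ`):
`A` is representable iff `A` embeds into the neat `ι`-reduct of some
cylindric algebra of dimension `ι ⊕ ℕ`; that is, `RCA_α = S Nr_α CA_{α+ω}`. -/
theorem neat_embedding_theorem {ι : Type u} (A : RawCA.{u, u} ι) (hA : A.IsCA) :
    A.Representable ↔
      ∃ (B : RawCA.{u, u} (ι ⊕ ℕ)) (f : A.carrier → B.carrier),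
        B.IsCA ∧ IsNeatEmbedding A B Sum.inl f := by
  exact ⟨fun h => h.exists_isNeatEmbedding,
    fun ⟨_, _, hB, hf⟩ => RawCA.representable_of_isNeatEmbedding hB hf⟩
end

section
/- Let 2<n<ω. The class of strongly representable CA_n atom structures is not elementary: there is no set of first-order sentences in the relational signature (T_i, E_ij)_{i,j<n} whose models are exactly the strongly representable CA_n atom structures. -/
universe u v w

/-- The relational first-order signature of `CA_n` atom structures:  unary
relation symbols `E_ij` (`i j < n`) and binary relation symbols `T_i`
(`i < n`). -/
def atomLang (n : ℕ) : FirstOrder.Language where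
  Functions := fun _ => Empty
  Relations := fun k =>
    match k with
    | 1 => Fin n × Fin n
    | 2 => Fin n
    | _ => Empty

/-- The complex algebra `Cm S` of a structure `S` in the signature of
`CA_n` atom structures:  the Boolean algebra of all subsets of `S` with
`c_i X = {y : ∃ x ∈ X, x T_i y}` and `d_ij = E_ij`. -/
def cmOf (n : ℕ) (B : Type) [str : (atomLang n).Structure B] : RawCA.{0, 0} (Fin n) where
  carrier := Set B
  add X Y := X ∪ Y
  mul X Y := X ∩ Y
  neg X := Xᶜ
  zero := ∅
  one := Set.univ
  c i X := {y | ∃ x ∈ X, str.RelMap (n := 2) (show (atomLang n).Relations 2 from i) ![x, y]}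
  d i j := {y | str.RelMap (n := 1) (show (atomLang n).Relations 1 from (i, j)) ![y]}

/-! ### Representations from labellings by ultrafilters -/

section Representation

open Filter

variable {n : ℕ} {B : Type}

/-- A family of ultrafilters of `Cm B`, indexed by the `n`-sequences in a set `U`, that respects the
diagonals and the cylindrifications and realizes every atom yields a representation of `Cm B`. -/
theorem representable_of_ultrafilters [str : (atomLang n).Structure B] {U : Type}
    (μ : (Fin n → U) → Ultrafilter B) (d : Fin n → Fin n → Set B) (c : Fin n → Set B → Set B)
    (hd : (cmOf n B).d = d) (hc : (cmOf n B).c = c)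
    (hdiag : ∀ s i j, d i j ∈ μ s ↔ s i = s j)
    (hcyl : ∀ s i (X : Set B), c i X ∈ μ s ↔
      ∃ t, X ∈ μ t ∧ ∀ j, j ≠ i → t j = s j)
    (hatom : ∀ a, ∃ s, {a} ∈ μ s) : (cmOf n B).Representable := by
  refine ⟨PUnit, fun _ => U, fun X _ => {s | (X : Set B) ∈ μ s}, ?_, ?_, ?_, ?_, ?_, ?_, ?_, ?_⟩
  · have key : ∀ X Y : Set B, (∀ s, X ∈ μ s ↔ Y ∈ μ s) → X ⊆ Y := by
      intro X Y h a ha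
      obtain ⟨s, hs⟩ := hatom a
      have hX : X ∈ μ s := mem_of_superset hs (by simpa using ha)
      obtain ⟨b, rfl, hb⟩ := (μ s).nonempty_of_mem (inter_mem hs ((h s).1 hX))
      exact hb
    intro X Y h
    have h' : ∀ s, (X : Set B) ∈ μ s ↔ (Y : Set B) ∈ μ s :=
      fun s => Set.ext_iff.1 (congrFun h PUnit.unit) s
    exact Set.Subset.antisymm (key X Y h') (key Y X fun s => (h' s).symm)
  · intro X Y
    funext _
    ext s
    exact Ultrafilter.union_mem_iff
  · intro X Y
    funext _
    ext s
    exact inter_mem_iff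
  · intro X
    funext _
    ext s
    exact Ultrafilter.compl_mem_iff_notMem
  · funext _
    ext s
    exact iff_of_false (μ s).empty_notMem (Set.notMem_empty _)
  · funext _
    ext s
    exact iff_of_true univ_mem (Set.mem_univ _)
  · intro i X
    funext _
    ext s
    rw [hc]
    exact hcyl s i X
  · intro i j
    funext _
    ext s
    rw [hd]
    exact hdiag s i j

end Representation

/-! ### The atom structure of a graph -/

/-- An atom of dimension `n` over a graph `G`: an equivalence relation on the coordinates together
with a labelling of the `n` faces (the `i`-th face omits the `i`-th coordinate) by vertices.
Degenerate faces carry the default label, equal faces carry equal labels, and the labels of a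
nondegenerate atom do not form an independent set. -/
@[ext]
structure FaceAtom (n : ℕ) {V : Type} [Inhabited V] (G : SimpleGraph V) where
  rel : Setoid (Fin n)
  lab : Fin n → V
  lab_default : ∀ i k l, k ≠ i → l ≠ i → k ≠ l → rel k l → lab i = default
  lab_congr : ∀ i j, rel i j → lab i = lab j
  edge : (∀ k l, rel k l → k = l) → ∃ i j, G.Adj (lab i) (lab j)

namespace FaceAtom

variable {n : ℕ} {V : Type} [Inhabited V] {G : SimpleGraph V}

/-- The part of an atom that does not involve the coordinate `i`. -/
def trace (i : Fin n) (a : FaceAtom n G) : (Fin n → Fin n → Prop) × V :=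
  (fun k l => k ≠ i ∧ l ≠ i ∧ a.rel k l, a.lab i)

instance : (atomLang n).Structure (FaceAtom n G) where
  funMap f := f.elim
  RelMap {k} r xs :=
    match k, r, xs with
    | 1, r, xs => (xs 0).rel (Prod.fst r) (Prod.snd r)
    | 2, i, xs => trace i (xs 0) = trace i (xs 1)

/-- The cylindrifications of the complex algebra. -/
def cyl (i : Fin n) (X : Set (FaceAtom n G)) : Set (FaceAtom n G) :=
  {a | ∃ x ∈ X, trace i x = trace i a}

theorem cmOf_c : (cmOf n (FaceAtom n G)).c = cyl := rfl

theorem cmOf_d : (cmOf n (FaceAtom n G)).d = fun i j => {a : FaceAtom n G | a.rel i j} := rfl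

theorem trace_eq_iff {i : Fin n} {a b : FaceAtom n G} :
    trace i a = trace i b ↔
      (∀ k l, k ≠ i → l ≠ i → (a.rel k l ↔ b.rel k l)) ∧ a.lab i = b.lab i := by
  simp only [trace, Prod.mk.injEq, funext_iff, eq_iff_iff]
  refine and_congr_left fun _ => forall₂_congr fun k l => ?_
  tauto

theorem rel_iff_of_trace_eq {i j : Fin n} (hij : i ≠ j) {a b : FaceAtom n G}
    (h : trace i a = trace i b) (ha : a.rel i j) (hb : b.rel i j) (k l : Fin n) :
    a.rel k l ↔ b.rel k l := by
  obtain ⟨h, -⟩ := trace_eq_iff.1 h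
  have side : ∀ c : FaceAtom n G, c.rel i j → ∀ m, (c.rel i m ↔ c.rel j m) := fun c hc m =>
    ⟨fun h => c.rel.trans (c.rel.symm hc) h, fun h => c.rel.trans hc h⟩
  by_cases hk : k = i <;> by_cases hl : l = i
  · subst hk; subst hl
    exact iff_of_true (a.rel.refl _) (b.rel.refl _)
  · subst hk
    rw [side a ha, side b hb, h j l hij.symm hl]
  · subst hl
    rw [a.rel.comm', b.rel.comm', side a ha, side b hb, h j k hij.symm hk]
  · exact h k l hk hl

theorem eq_of_trace_eq {i j : Fin n} (hij : i ≠ j) {a b : FaceAtom n G}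
    (h : trace i a = trace i b) (ha : a.rel i j) (hb : b.rel i j) : a = b := by
  have hr := rel_iff_of_trace_eq hij h ha hb
  have hi := (trace_eq_iff.1 h).2
  refine FaceAtom.ext (Setoid.ext hr) (funext fun l => ?_)
  by_cases hl : l = i
  · rw [hl, hi]
  by_cases hl' : l = j
  · rw [hl', ← a.lab_congr i j ha, ← b.lab_congr i j hb, hi]
  · rw [a.lab_default l i j (Ne.symm hl) (Ne.symm hl') hij ha,
      b.lab_default l i j (Ne.symm hl) (Ne.symm hl') hij hb]

/-- Replacing the coordinate `i` of an atom by its coordinate `j`. -/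
theorem exists_rel_trace_eq (a : FaceAtom n G) {i j : Fin n} (hij : i ≠ j) :
    ∃ b : FaceAtom n G, trace i b = trace i a ∧ b.rel i j := by
  classical
  have upd : ∀ k, k ≠ i → Function.update id i j k = k := fun k hk => by simp [hk]
  have updi : Function.update id i j i = j := by simp
  have degenerate : ∀ k, k ≠ i → a.rel j k → k ≠ j → a.lab i = default := fun k hk h hkj =>
    a.lab_default i j k hij.symm hk hkj.symm h
  refine ⟨⟨a.rel.comap (Function.update id i j), fun l => if l = i ∨ l = j then a.lab i else default,
    ?_, ?_, ?_⟩, ?_, ?_⟩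
  · intro m k l hk hl hkl h
    change a.rel (Function.update id i j k) (Function.update id i j l) at h
    split_ifs with hm
    · rcases hm with rfl | rfl
      · rw [upd k hk, upd l hl] at h
        exact a.lab_default m k l hk hl hkl h
      · by_cases hki : k = i
        · subst hki
          rw [updi, upd l hkl.symm] at h
          exact degenerate l hkl.symm h hl
        · by_cases hli : l = i
          · subst hli
            rw [updi, upd k hki] at h
            exact degenerate k hki (a.rel.symm h) hk
          · rw [upd k hki, upd l hli] at h
            exact a.lab_default i k l hki hli hkl h
    · rfl
  · intro k l h
    change a.rel (Function.update id i j k) (Function.update id i j l) at h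
    have key : ∀ m, m ≠ i → m ≠ j → ∀ p, p = i ∨ p = j →
        a.rel (Function.update id i j p) (Function.update id i j m) → a.lab i = default := by
      intro m hmi hmj p hp h
      rw [upd m hmi] at h
      refine degenerate m hmi ?_ hmj
      rcases hp with rfl | rfl
      · rwa [updi] at h
      · rwa [upd p hij.symm] at h
    split_ifs with h1 h2 h2
    · rfl
    · push Not at h2
      exact key l h2.1 h2.2 k h1 h
    · push Not at h1
      exact (key k h1.1 h1.2 l h2 (a.rel.symm h)).symm
    · rfl
  · intro h
    refine absurd (h i j ?_) hij
    change a.rel (Function.update id i j i) (Function.update id i j j)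
    rw [updi, upd j hij.symm]
  · refine trace_eq_iff.2 ⟨fun k l hk hl => ?_, by simp⟩
    change a.rel (Function.update id i j k) (Function.update id i j l) ↔ _
    rw [upd k hk, upd l hl]
  · change a.rel (Function.update id i j i) (Function.update id i j j)
    rw [updi, upd j hij.symm]

instance [Fact (2 < n)] : Nonempty (FaceAtom n G) := by
  have hn : 2 < n := Fact.out
  refine ⟨⟨⊤, fun _ => default, fun _ _ _ _ _ _ _ => rfl, fun _ _ _ => rfl, fun h => ?_⟩⟩
  have := h ⟨0, by omega⟩ ⟨1, by omega⟩ trivial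
  simp at this

end FaceAtom

/-! ### Adjacent ultrafilters -/

section UltrafilterAdj

open Filter

variable {V : Type} {G : SimpleGraph V}

/-- Two ultrafilters on the vertices are adjacent if any two members are joined by an edge. -/
def UltrafilterAdj (G : SimpleGraph V) (p q : Ultrafilter V) : Prop :=
  ∀ A ∈ p, ∀ B ∈ q, ∃ v ∈ A, ∃ w ∈ B, G.Adj v w

theorem UltrafilterAdj.symm {p q : Ultrafilter V} (h : UltrafilterAdj G p q) :
    UltrafilterAdj G q p := fun A hA B hB =>
  let ⟨v, hv, w, hw, e⟩ := h B hB A hA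
  ⟨w, hw, v, hv, e.symm⟩

theorem ultrafilterAdj_map {S : Type} {μ : Ultrafilter S} {f g : S → V}
    (h : ∀ᶠ a in μ, G.Adj (f a) (g a)) : UltrafilterAdj G (μ.map f) (μ.map g) := by
  intro A hA B hB
  obtain ⟨a, ⟨ha, hb⟩, e⟩ := μ.nonempty_of_mem (inter_mem (inter_mem hA hB) h)
  exact ⟨f a, ha, g a, hb, e⟩

theorem Ultrafilter.map_congr' {S T : Type} {μ : Ultrafilter S} {f g : S → T}
    (h : ∀ᶠ a in μ, f a = g a) : μ.map f = μ.map g :=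
  Ultrafilter.coe_injective (Filter.map_congr h)

theorem Ultrafilter.exists_map_eval {W : Type} (p : W → Ultrafilter V) :
    ∃ ρ : Ultrafilter (W → V), ∀ w, ρ.map (fun g => g w) = p w := by
  obtain ⟨ρ, hρ⟩ := Ultrafilter.exists_le (Filter.pi fun w => (p w : Filter V))
  refine ⟨ρ, fun w => Ultrafilter.coe_le_coe.1 ?_⟩
  exact (Filter.map_mono hρ).trans (Filter.tendsto_eval_pi _ w)

theorem UltrafilterAdj.exists_map_eval {W : Type} (p : W → Ultrafilter V) {w w' : W}
    (hw : w ≠ w') (h : UltrafilterAdj G (p w) (p w')) :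
    ∃ ρ : Ultrafilter (W → V), (∀ w, ρ.map (fun g => g w) = p w) ∧
      ∀ᶠ g : W → V in ρ, G.Adj (g w) (g w') := by
  classical
  have hne : NeBot ((Filter.pi fun w => (p w : Filter V)) ⊓
      𝓟 {g : W → V | G.Adj (g w) (g w')}) := by
    rw [inf_principal_neBot_iff]
    intro X hX
    obtain ⟨I, -, t, ht, hsub⟩ := Filter.mem_pi.1 hX
    obtain ⟨v, hv, v', hv', e⟩ := h (t w) (ht w) (t w') (ht w')
    choose g hg using fun w => (p w).nonempty_of_mem (ht w)
    refine ⟨Function.update (Function.update g w v) w' v', hsub fun x _ => ?_, ?_⟩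
    · by_cases hx' : x = w'
      · subst hx'
        simpa using hv'
      by_cases hx : x = w
      · subst hx
        simpa [hx'] using hv
      · simpa [hx, hx'] using hg x
    · simpa [hw] using e
  obtain ⟨ρ, hρ⟩ := Ultrafilter.exists_le _ (h := hne)
  refine ⟨ρ, fun w => Ultrafilter.coe_le_coe.1 ?_, ?_⟩
  · exact (Filter.map_mono (hρ.trans inf_le_left)).trans (Filter.tendsto_eval_pi _ w)
  · exact (hρ.trans inf_le_right) (mem_principal_self _)

end UltrafilterAdj

/-! ### The free network -/

section Network

open Filter

open scoped Classical in
/-- The `l`-th face of a sequence: the set of all entries but the `l`-th one. -/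
noncomputable def face {n : ℕ} {P : Type} (s : Fin n → P) (l : Fin n) : Finset P :=
  (Finset.univ.erase l).image s

section Face

variable {n : ℕ} {P : Type} {s t : Fin n → P} {l m : Fin n}

theorem mem_face {x : P} : x ∈ face s l ↔ ∃ k, k ≠ l ∧ s k = x := by
  simp [face]

theorem face_congr (h : ∀ k, k ≠ l → s k = t k) : face s l = face t l := by
  ext x
  simp only [mem_face]
  exact exists_congr fun k => and_congr_right fun hk => by rw [h k hk]

theorem card_face_eq_iff :
    (face s l).card = n - 1 ↔ ∀ j k, j ≠ l → k ≠ l → s j = s k → j = k := by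
  classical
  have : (Finset.univ.erase l : Finset (Fin n)).card = n - 1 := by simp
  rw [← this, face, Finset.card_image_iff]
  simp only [Set.InjOn, Finset.coe_erase, Finset.coe_univ, Set.mem_sdiff, Set.mem_univ, true_and,
    Set.mem_singleton_iff]
  exact ⟨fun h j k hj hk => h hj hk, fun h j hj k hk => h j k hj hk⟩

theorem face_eq_of_eq (h : s l = s m) : face s l = face s m := by
  have key : ∀ {l m : Fin n}, s l = s m → face s l ⊆ face s m := by
    intro l m h x hx
    obtain ⟨k, hk, rfl⟩ := mem_face.1 hx
    by_cases hkm : k = m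
    · subst hkm
      exact mem_face.2 ⟨l, hk.symm, h⟩
    · exact mem_face.2 ⟨k, hkm, rfl⟩
  exact (key h).antisymm (key h.symm)

theorem eq_of_face_eq (h : face s l = face s m) (hc : (face s m).card = n - 1) : s l = s m := by
  by_contra hlm
  have hne : l ≠ m := fun e => hlm (by rw [e])
  have hl : s l ∈ face s l := h ▸ mem_face.2 ⟨l, hne, rfl⟩
  obtain ⟨k, hk, hkl⟩ := mem_face.1 hl
  by_cases hkm : k = m
  · exact hlm (by rw [← hkl, hkm])
  · exact hk (card_face_eq_iff.1 hc k l hkm hne hkl)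

theorem card_face_of_injective (hs : Function.Injective s) : (face s l).card = n - 1 :=
  card_face_eq_iff.2 fun _ _ _ _ h => hs h

end Face

/-- The points of the free network: a root, and for every sequence `b` of points, every coordinate
`i` and every ultrafilter on the atoms a point that is put at place `i` of `b`. -/
inductive Pt (n : ℕ) (S : Type) : Type
  | root : Pt n S
  | ext (b : Fin n → Pt n S) (i : Fin n) (μ : Ultrafilter S) : Pt n S

namespace Pt

variable {n : ℕ} {S : Type}

/-- The depth of a point as a term. -/
def depth : Pt n S → ℕ
  | root => 0
  | ext b _ _ => (Finset.univ.sup fun j => depth (b j)) + 1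

theorem depth_lt (b : Fin n → Pt n S) (i j : Fin n) (μ : Ultrafilter S) :
    (b j).depth < (ext b i μ).depth := by
  rw [depth]
  exact Nat.lt_succ_of_le (Finset.le_sup (f := fun j => depth (b j)) (Finset.mem_univ j))

/-- The sequence for which the point `ext b i μ` has been created. -/
def tup (b : Fin n → Pt n S) (i : Fin n) (μ : Ultrafilter S) : Fin n → Pt n S :=
  Function.update b i (ext b i μ)

@[simp] theorem tup_self (b : Fin n → Pt n S) (i : Fin n) (μ : Ultrafilter S) :
    tup b i μ i = ext b i μ := Function.update_self ..

theorem tup_of_ne {b : Fin n → Pt n S} {i j : Fin n} (μ : Ultrafilter S) (h : j ≠ i) :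
    tup b i μ j = b j := Function.update_of_ne h ..

theorem tup_eq_or_lt (b : Fin n → Pt n S) (i j : Fin n) (μ : Ultrafilter S) :
    tup b i μ j = ext b i μ ∨ (tup b i μ j).depth < (ext b i μ).depth := by
  by_cases h : j = i
  · exact Or.inl (by rw [h, tup_self])
  · exact Or.inr (by rw [tup_of_ne μ h]; exact depth_lt b i j μ)

theorem tup_injective {b b' : Fin n → Pt n S} {i i' : Fin n} {μ μ' : Ultrafilter S}
    (h : tup b i μ = tup b' i' μ') : ext b i μ = ext b' i' μ' := by
  have h1 := tup_eq_or_lt b' i' i μ'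
  have h2 := tup_eq_or_lt b i i' μ
  rw [← h, tup_self] at h1
  rw [h, tup_self] at h2
  rcases h1 with h1 | h1
  · exact h1
  · rcases h2 with h2 | h2
    · exact h2.symm
    · omega

end Pt

variable {n : ℕ} {V : Type} [Inhabited V] {G : SimpleGraph V}

/-- `F` is a face of the sequence of one of its members `ext b i μ`, and `p` is the label of this
face according to `μ`. -/
def IsFaceLabel (F : Finset (Pt n (FaceAtom n G))) (p : Ultrafilter V) : Prop :=
  ∃ b i μ l, l ≠ i ∧ F = face (Pt.tup b i μ) l ∧ p = μ.map fun a => a.lab l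

/-- A set of pairwise adjacent ultrafilters that contains a common neighbour of any `n * n`
ultrafilters. -/
def IsDefaultSet (n : ℕ) (G : SimpleGraph V) (D : Set (Ultrafilter V)) : Prop :=
  (∀ p ∈ D, ∀ q ∈ D, UltrafilterAdj G p q) ∧
    ∀ 𝓕 : Finset (Ultrafilter V), 𝓕.card ≤ n * n → ∃ d ∈ D, ∀ p ∈ 𝓕, UltrafilterAdj G d p

theorem IsDefaultSet.exists_label {D : Set (Ultrafilter V)} (hD : IsDefaultSet n G D)
    (F : Finset (Pt n (FaceAtom n G))) : ∃ p : Ultrafilter V,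
      (F.card ≠ n - 1 → p = pure default) ∧
      (F.card = n - 1 → (∃ p, IsFaceLabel F p) → IsFaceLabel F p) ∧
      (F.card = n - 1 → (¬ ∃ p, IsFaceLabel F p) → p ∈ D ∧
        ∀ b i μ l, Pt.ext b i μ ∈ F → UltrafilterAdj G p (μ.map fun a => a.lab l)) := by
  classical
  by_cases hF : F.card = n - 1
  · by_cases h : ∃ p, IsFaceLabel F p
    · obtain ⟨p, hp⟩ := h
      exact ⟨p, fun h => absurd hF h, fun _ _ => hp, fun _ h => absurd ⟨p, hp⟩ h⟩
    · let forb : Pt n (FaceAtom n G) → Finset (Ultrafilter V) := fun z =>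
        match z with
        | .root => ∅
        | .ext _ _ μ => Finset.univ.image fun l => μ.map fun a => a.lab l
      have hforb : ∀ z, (forb z).card ≤ n := by
        intro z
        cases z with
        | root => simp [forb]
        | ext b i μ => exact Finset.card_image_le.trans (by simp)
      obtain ⟨d, hd, hadj⟩ := hD.2 (F.biUnion forb)
        ((Finset.card_biUnion_le_card_mul _ _ _ fun z _ => hforb z).trans
          (Nat.mul_le_mul_right _ (by omega)))
      refine ⟨d, fun h => absurd hF h, fun _ h' => absurd h' h, fun _ _ => ⟨hd, ?_⟩⟩
      intro b i μ l hz
      exact hadj _ (Finset.mem_biUnion.2 ⟨_, hz, Finset.mem_image.2 ⟨l, Finset.mem_univ _, rfl⟩⟩)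
  · exact ⟨pure default, fun _ => rfl, fun h => absurd h hF, fun h => absurd h hF⟩

/-- A labelling of the sets of points of the free network: the faces of the sequence of a point are
labelled as this point demands, all other faces get a default label. -/
structure IsLabelling (D : Set (Ultrafilter V))
    (Λ : Finset (Pt n (FaceAtom n G)) → Ultrafilter V) : Prop where
  adj : ∀ p ∈ D, ∀ q ∈ D, UltrafilterAdj G p q
  small : ∀ F, F.card ≠ n - 1 → Λ F = pure default
  faceLabel : ∀ F, F.card = n - 1 → (∃ p, IsFaceLabel F p) → IsFaceLabel F (Λ F)
  mem : ∀ F, F.card = n - 1 → (¬ ∃ p, IsFaceLabel F p) → Λ F ∈ D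
  adj_map : ∀ F, F.card = n - 1 → (¬ ∃ p, IsFaceLabel F p) →
    ∀ b i μ l, Pt.ext b i μ ∈ F → UltrafilterAdj G (Λ F) (μ.map fun a => a.lab l)

theorem IsDefaultSet.exists_isLabelling {D : Set (Ultrafilter V)} (hD : IsDefaultSet n G D) :
    ∃ Λ : Finset (Pt n (FaceAtom n G)) → Ultrafilter V, IsLabelling D Λ := by
  choose Λ h1 h2 h3 using hD.exists_label
  exact ⟨Λ, hD.1, h1, h2, fun F hF h => (h3 F hF h).1, fun F hF h => (h3 F hF h).2⟩

/-- The ultrafilter `μ` describes the sequence `s`. -/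
structure Describes (Λ : Finset (Pt n (FaceAtom n G)) → Ultrafilter V)
    (s : Fin n → Pt n (FaceAtom n G)) (μ : Ultrafilter (FaceAtom n G)) : Prop where
  rel : ∀ k l, (∀ᶠ a : FaceAtom n G in μ, a.rel k l) ↔ s k = s l
  lab : ∀ l, (μ.map fun a => a.lab l) = Λ (face s l)

/-- The points of the free network whose demands are consistent with the labelling. -/
inductive Valid (Λ : Finset (Pt n (FaceAtom n G)) → Ultrafilter V) : Pt n (FaceAtom n G) → Prop
  | root : Valid Λ .root
  | ext (b : Fin n → Pt n (FaceAtom n G)) (i : Fin n) (μ : Ultrafilter (FaceAtom n G))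
      (hb : ∀ j, Valid Λ (b j))
      (hrel : ∀ k l, k ≠ i → l ≠ i → ((∀ᶠ a : FaceAtom n G in μ, a.rel k l) ↔ b k = b l))
      (hnew : ∀ k, k ≠ i → ¬ ∀ᶠ a : FaceAtom n G in μ, a.rel i k)
      (hlab : (μ.map fun a => a.lab i) = Λ (face b i)) : Valid Λ (.ext b i μ)

variable {D : Set (Ultrafilter V)} {Λ : Finset (Pt n (FaceAtom n G)) → Ultrafilter V}

theorem Valid.describes (hΛ : IsLabelling D Λ) {b : Fin n → Pt n (FaceAtom n G)} {i : Fin n}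
    {μ : Ultrafilter (FaceAtom n G)} (hz : Valid Λ (.ext b i μ)) :
    Describes Λ (Pt.tup b i μ) μ := by
  obtain _ | ⟨_, _, _, hb, hrel, hnew, hlab⟩ := hz
  have hne : ∀ k, k ≠ i → Pt.tup b i μ k ≠ Pt.ext b i μ := fun k hk h => by
    rw [Pt.tup_of_ne μ hk] at h
    exact (Pt.depth_lt b i k μ).ne (by rw [h])
  have hR : ∀ k l, (∀ᶠ a : FaceAtom n G in μ, a.rel k l) ↔ Pt.tup b i μ k = Pt.tup b i μ l := by
    intro k l
    by_cases hk : k = i <;> by_cases hl : l = i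
    · subst hk; subst hl
      exact iff_of_true (Eventually.of_forall fun a => a.rel.refl _) rfl
    · subst hk
      rw [Pt.tup_self]
      exact iff_of_false (hnew l hl) fun h => hne l hl h.symm
    · subst hl
      rw [Pt.tup_self]
      refine iff_of_false (fun h => hnew k hk ?_) (hne k hk)
      exact h.mono fun a ha => a.rel.symm ha
    · rw [Pt.tup_of_ne μ hk, Pt.tup_of_ne μ hl, hrel k l hk hl]
  refine ⟨hR, fun l => ?_⟩
  by_cases hc : (face (Pt.tup b i μ) l).card = n - 1
  · by_cases hl : l = i
    · subst hl
      rw [hlab]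
      exact congrArg Λ (face_congr fun k hk => (Pt.tup_of_ne μ hk).symm)
    obtain ⟨b', i', μ', l', hl', hF, hp⟩ := hΛ.faceLabel _ hc ⟨_, b, i, μ, l, hl, rfl, rfl⟩
    have hz1 : Pt.ext b i μ ∈ face (Pt.tup b' i' μ') l' :=
      hF ▸ mem_face.2 ⟨i, Ne.symm hl, Pt.tup_self ..⟩
    have hz2 : Pt.ext b' i' μ' ∈ face (Pt.tup b i μ) l :=
      hF ▸ mem_face.2 ⟨i', Ne.symm hl', Pt.tup_self ..⟩
    obtain ⟨k, -, hk⟩ := mem_face.1 hz1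
    obtain ⟨k', -, hk'⟩ := mem_face.1 hz2
    have hzz : Pt.ext b i μ = Pt.ext b' i' μ' := by
      rcases Pt.tup_eq_or_lt b' i' k μ' with h | h
      · rw [← hk, h]
      · rcases Pt.tup_eq_or_lt b i k' μ with h' | h'
        · rw [← hk', h']
        · rw [hk] at h
          rw [hk'] at h'
          omega
    injection hzz with h1 h2 h3
    subst h1; subst h2; subst h3
    rw [hp]
    refine Ultrafilter.map_congr' ?_
    exact ((hR l l').2 (eq_of_face_eq hF (hF ▸ hc))).mono fun a ha => a.lab_congr _ _ ha
  · have hpure : (pure default : Ultrafilter V) = μ.map fun _ => default :=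
      Ultrafilter.coe_injective Filter.map_const.symm
    rw [hΛ.small _ hc, hpure]
    rw [card_face_eq_iff] at hc
    push Not at hc
    obtain ⟨j, k, hj, hk, hjk, hne'⟩ := hc
    refine Ultrafilter.map_congr' ?_
    exact ((hR j k).2 hjk).mono fun a ha => a.lab_default l j k hj hk hne' ha

theorem Describes.exists_adj {t : Fin n → Pt n (FaceAtom n G)} {μ : Ultrafilter (FaceAtom n G)}
    (ht : Describes Λ t μ) (hinj : Function.Injective t) :
    ∃ l m, l ≠ m ∧ UltrafilterAdj G (Λ (face t l)) (Λ (face t m)) := by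
  have htriv : ∀ᶠ a : FaceAtom n G in μ, ∀ k l, a.rel k l → k = l := by
    refine eventually_all.2 fun k => eventually_all.2 fun l => ?_
    by_cases hkl : k = l
    · exact Eventually.of_forall fun _ _ => hkl
    · have := Ultrafilter.eventually_not.2 (mt (ht.rel k l).1 (hinj.ne hkl))
      exact this.mono fun a ha h => absurd h ha
  have hedge : ∀ᶠ a : FaceAtom n G in μ, ∃ l m, G.Adj (a.lab l) (a.lab m) :=
    htriv.mono fun a ha => a.edge ha
  obtain ⟨l, hl⟩ := Ultrafilter.eventually_exists_iff.1 hedge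
  obtain ⟨m, hm⟩ := Ultrafilter.eventually_exists_iff.1 hl
  refine ⟨l, m, ?_, ?_⟩
  · rintro rfl
    obtain ⟨a, ha⟩ := hm.exists
    exact G.loopless.irrefl _ ha
  · rw [← ht.lab, ← ht.lab]
    exact ultrafilterAdj_map hm

theorem exists_adj_faces (hn : 2 < n) (hΛ : IsLabelling D Λ) {s : Fin n → Pt n (FaceAtom n G)}
    (hs : ∀ j, Valid Λ (s j)) (hinj : Function.Injective s) :
    ∃ l m, l ≠ m ∧ UltrafilterAdj G (Λ (face s l)) (Λ (face s m)) := by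
  classical
  obtain ⟨j, -, hmax⟩ := Finset.exists_max_image Finset.univ (fun j => (s j).depth)
    ⟨⟨0, by omega⟩, Finset.mem_univ _⟩
  have hcard : ∀ l, (face s l).card = n - 1 := fun _ => card_face_of_injective hinj
  -- a face through the deepest point that is labelled at all is labelled by this point
  have htop : ∀ l, l ≠ j → (∃ p, IsFaceLabel (face s l) p) → ∃ b i μ l', l' ≠ i ∧
      s j = Pt.ext b i μ ∧ face s l = face (Pt.tup b i μ) l' ∧
      Λ (face s l) = μ.map fun a => a.lab l' := by
    intro l hl h
    obtain ⟨b, i, μ, l', hl', hF, hp⟩ := hΛ.faceLabel _ (hcard l) h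
    refine ⟨b, i, μ, l', hl', ?_, hF, hp⟩
    have hz : Pt.ext b i μ ∈ face s l := hF ▸ mem_face.2 ⟨i, Ne.symm hl', Pt.tup_self ..⟩
    obtain ⟨k, -, hk⟩ := mem_face.1 hz
    have hj : s j ∈ face (Pt.tup b i μ) l' := hF ▸ mem_face.2 ⟨j, Ne.symm hl, rfl⟩
    obtain ⟨k', -, hk'⟩ := mem_face.1 hj
    rcases Pt.tup_eq_or_lt b i k' μ with h' | h'
    · rw [← hk', h']
    · have := hmax k (Finset.mem_univ _)
      rw [hk'] at h'
      rw [hk] at this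
      omega
  have hhalf : ∀ l m, l ≠ j → m ≠ j → (∃ p, IsFaceLabel (face s l) p) →
      (¬ ∃ p, IsFaceLabel (face s m) p) → UltrafilterAdj G (Λ (face s m)) (Λ (face s l)) := by
    intro l m hl hm hL hM
    obtain ⟨b, i, μ, l', -, hz, -, hp⟩ := htop l hl hL
    rw [hp]
    exact hΛ.adj_map _ (hcard m) hM b i μ l' (hz ▸ mem_face.2 ⟨j, Ne.symm hm, rfl⟩)
  obtain ⟨l, m, hl, hm, hlm⟩ : ∃ l m : Fin n, l ≠ j ∧ m ≠ j ∧ l ≠ m := by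
    have h2 : 1 < (Finset.univ.erase j).card := by simp; omega
    obtain ⟨l, hl, m, hm, hlm⟩ := Finset.one_lt_card.1 h2
    exact ⟨l, m, Finset.ne_of_mem_erase hl, Finset.ne_of_mem_erase hm, hlm⟩
  by_cases hL : ∃ p, IsFaceLabel (face s l) p <;> by_cases hM : ∃ p, IsFaceLabel (face s m) p
  · obtain ⟨b, i, μ, l', -, hz, hFl, -⟩ := htop l hl hL
    obtain ⟨b', i', μ', m', -, hz', hFm, -⟩ := htop m hm hM
    have hzz := hz.symm.trans hz'
    injection hzz with h1 h2 h3
    subst h1; subst h2; subst h3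
    set t := Pt.tup b i μ with ht
    have hsub : Finset.univ.image s ⊆ Finset.univ.image t := by
      have hface : ∀ k x, x ∈ face t k → x ∈ Finset.univ.image t := fun k x hx =>
        let ⟨k', _, h⟩ := mem_face.1 hx
        Finset.mem_image.2 ⟨k', Finset.mem_univ _, h⟩
      intro x hx
      obtain ⟨k, -, rfl⟩ := Finset.mem_image.1 hx
      by_cases hk : k = l
      · exact hface m' _ (hFm ▸ mem_face.2 ⟨k, hk ▸ hlm, rfl⟩)
      · exact hface l' _ (hFl ▸ mem_face.2 ⟨k, hk, rfl⟩)
    have hcs : (Finset.univ.image s).card = n := by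
      rw [Finset.card_image_of_injective _ hinj, Finset.card_univ, Fintype.card_fin]
    have hct : (Finset.univ.image t).card ≤ n := Finset.card_image_le.trans (by simp)
    have himage := Finset.eq_of_subset_of_card_le hsub (hct.trans hcs.ge)
    have htinj : Function.Injective t := by
      refine Set.injOn_univ.1 ?_
      rw [← Finset.coe_univ, ← Finset.card_image_iff, ← himage, hcs, Finset.card_univ,
        Fintype.card_fin]
    obtain ⟨x, y, hxy, hadj⟩ := (Valid.describes hΛ (hz ▸ hs j)).exists_adj htinj
    have hfaces : ∀ x, ∃ k, s k = t x ∧ face s k = face t x := by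
      intro x
      obtain ⟨k, -, hk⟩ := Finset.mem_image.1
        (himage ▸ Finset.mem_image_of_mem t (Finset.mem_univ x))
      refine ⟨k, hk, ?_⟩
      have her : ∀ {r : Fin n → Pt n (FaceAtom n G)}, Function.Injective r → ∀ k,
          face r k = (Finset.univ.image r).erase (r k) := fun hr k => by
        rw [face, Finset.image_erase hr]
      rw [her hinj, her htinj, himage, hk]
    obtain ⟨k, hk, hk'⟩ := hfaces x
    obtain ⟨k₁, hk₁, hk₁'⟩ := hfaces y
    refine ⟨k, k₁, fun h => hxy (htinj (by rw [← hk, ← hk₁, h])), ?_⟩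
    rwa [hk', hk₁']
  · exact ⟨m, l, hlm.symm, hhalf l m hl hm hL hM⟩
  · exact ⟨l, m, hlm, hhalf m l hm hl hM hL⟩
  · exact ⟨l, m, hlm, hΛ.adj _ (hΛ.mem _ (hcard l) hL) _ (hΛ.mem _ (hcard m) hM)⟩

/-- The atom with kernel that of `s` and labels given by `g`. -/
noncomputable def atomOf (s : Fin n → Pt n (FaceAtom n G)) (g : Finset (Pt n (FaceAtom n G)) → V)
    (h : Function.Injective s → ∃ l m, G.Adj (g (face s l)) (g (face s m))) : FaceAtom n G where
  rel := Setoid.ker s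
  lab l := if (face s l).card = n - 1 then g (face s l) else default
  lab_default i k l hk hl hkl hs :=
    if_neg fun hc => hkl (card_face_eq_iff.1 hc k l hk hl hs)
  lab_congr i j hs := by rw [face_eq_of_eq hs]
  edge htriv := by
    have hinj : Function.Injective s := fun k l hkl => htriv k l hkl
    simpa only [card_face_of_injective hinj, if_true] using h hinj

theorem exists_describes (hn : 2 < n) (hΛ : IsLabelling D Λ) {s : Fin n → Pt n (FaceAtom n G)}
    (hs : ∀ j, Valid Λ (s j)) : ∃ μ, Describes Λ s μ := by
  classical
  have : Fact (2 < n) := ⟨hn⟩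
  obtain ⟨ρ, hρ, hadj⟩ : ∃ ρ : Ultrafilter (Finset (Pt n (FaceAtom n G)) → V),
      (∀ F, ρ.map (fun g => g F) = Λ F) ∧ ∀ᶠ g : Finset (Pt n (FaceAtom n G)) → V in ρ,
        (Function.Injective s → ∃ l m, G.Adj (g (face s l)) (g (face s m))) := by
    by_cases hinj : Function.Injective s
    · obtain ⟨l, m, hlm, h⟩ := exists_adj_faces hn hΛ hs hinj
      obtain ⟨ρ, hρ, hadj⟩ := h.exists_map_eval Λ
        fun e => hlm (hinj (eq_of_face_eq e (card_face_of_injective hinj)))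
      exact ⟨ρ, hρ, hadj.mono fun g hg _ => ⟨l, m, hg⟩⟩
    · obtain ⟨ρ, hρ⟩ := Ultrafilter.exists_map_eval Λ
      exact ⟨ρ, hρ, Eventually.of_forall fun g h => absurd h hinj⟩
  let f : (Finset (Pt n (FaceAtom n G)) → V) → FaceAtom n G := fun g =>
    if h : Function.Injective s → ∃ l m, G.Adj (g (face s l)) (g (face s m)) then atomOf s g h
    else Classical.arbitrary _
  have hf : ∀ᶠ g : Finset (Pt n (FaceAtom n G)) → V in ρ, ∃ h, f g = atomOf s g h :=
    hadj.mono fun g h => ⟨h, dif_pos h⟩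
  refine ⟨ρ.map f, fun k l => ?_, fun l => ?_⟩
  · change (∀ᶠ g : Finset (Pt n (FaceAtom n G)) → V in ρ, (f g).rel k l) ↔ _
    refine ⟨fun h => ?_, fun h => ?_⟩
    · obtain ⟨g, hg, h', e⟩ := (h.and hf).exists
      rw [e] at hg
      exact hg
    · refine hf.mono fun g ⟨h', e⟩ => ?_
      rw [e]
      exact h
  · rw [Ultrafilter.map_map]
    by_cases hc : (face s l).card = n - 1
    · rw [← hρ]
      refine Ultrafilter.map_congr' (hf.mono fun g ⟨h', e⟩ => ?_)
      simp only [Function.comp_apply, e, atomOf, hc, if_true]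
    · have hpure : (pure default : Ultrafilter V) = ρ.map fun _ => default :=
        Ultrafilter.coe_injective Filter.map_const.symm
      rw [hΛ.small _ hc, hpure]
      refine Ultrafilter.map_congr' (hf.mono fun g ⟨h', e⟩ => ?_)
      simp only [Function.comp_apply, e, atomOf, hc, if_false]

theorem exists_describes_tup (hn : 2 < n) (hΛ : IsLabelling D Λ)
    {s : Fin n → Pt n (FaceAtom n G)} (hs : ∀ j, Valid Λ (s j)) :
    ∃ μ, Describes Λ s μ ∧ ∀ b i μ', s = Pt.tup b i μ' → μ = μ' := by
  by_cases h : ∃ b i μ', s = Pt.tup b i μ'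
  · obtain ⟨b, i, μ, rfl⟩ := h
    have hz := hs i
    rw [Pt.tup_self] at hz
    refine ⟨μ, hz.describes hΛ, fun b' i' μ' h => ?_⟩
    have := Pt.tup_injective h
    injection this
  · obtain ⟨μ, hμ⟩ := exists_describes hn hΛ hs
    exact ⟨μ, hμ, fun b i μ' e => absurd ⟨b, i, μ', e⟩ h⟩

variable {s t : Fin n → Pt n (FaceAtom n G)} {μ ν : Ultrafilter (FaceAtom n G)}

theorem Describes.eventually_rel_iff (hs : Describes Λ s μ) :
    ∀ᶠ a : FaceAtom n G in μ, ∀ k l, a.rel k l ↔ s k = s l := by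
  refine eventually_all.2 fun k => eventually_all.2 fun l => ?_
  by_cases h : s k = s l
  · exact ((hs.rel k l).2 h).mono fun a ha => iff_of_true ha h
  · have := Ultrafilter.eventually_not.2 (mt (hs.rel k l).1 h)
    exact this.mono fun a ha => iff_of_false ha h

theorem Describes.cyl_mem (hs : Describes Λ s μ) (ht : Describes Λ t ν) {i : Fin n}
    (hst : ∀ j, j ≠ i → t j = s j) {X : Set (FaceAtom n G)} (hX : X ∈ ν) :
    FaceAtom.cyl i X ∈ μ := by
  let Y : Set (FaceAtom n G) := X ∩ {a | ∀ k l, a.rel k l ↔ t k = t l}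
  have hY : Y ∈ ν := inter_mem hX ht.eventually_rel_iff
  have hlab : (fun a : FaceAtom n G => a.lab i) '' Y ∈ μ.map fun a => a.lab i := by
    rw [hs.lab, ← face_congr hst, ← ht.lab]
    exact image_mem_map hY
  have hlab' : ∀ᶠ a : FaceAtom n G in μ, a.lab i ∈ (fun a : FaceAtom n G => a.lab i) '' Y := hlab
  filter_upwards [hlab', hs.eventually_rel_iff] with a ⟨x, ⟨hxX, hx⟩, hxa⟩ ha
  refine ⟨x, hxX, FaceAtom.trace_eq_iff.2 ⟨fun k l hk hl => ?_, hxa⟩⟩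
  rw [hx, ha, hst k hk, hst l hl]

/-- The witness for a cylindrification inside a diagonal. -/
theorem Describes.mem_of_cyl_diag_mem (hs : Describes Λ s μ) {i j : Fin n} (hij : i ≠ j)
    (ht : Describes Λ (Function.update s i (s j)) ν) {X : Set (FaceAtom n G)}
    (hX : FaceAtom.cyl i (X ∩ {a | a.rel i j}) ∈ μ) : X ∈ ν := by
  by_contra hX'
  have hd : {a : FaceAtom n G | a.rel i j} ∈ ν :=
    (ht.rel i j).2 (by simp [Function.update_of_ne hij.symm])
  have h := hs.cyl_mem ht (fun k hk => Function.update_of_ne hk ..)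
    (inter_mem (Ultrafilter.compl_mem_iff_notMem.2 hX') hd)
  obtain ⟨a, ⟨x, ⟨hx, hxd⟩, hxa⟩, y, ⟨hy, hyd⟩, hya⟩ := μ.nonempty_of_mem (inter_mem hX h)
  exact hy (FaceAtom.eq_of_trace_eq hij (hxa.trans hya.symm) hxd hyd ▸ hx)

/-- The witness for a cylindrification outside all diagonals. -/
theorem Describes.exists_valid (hs : Describes Λ s μ) (hv : ∀ j, Valid Λ (s j)) {i : Fin n}
    {X : Set (FaceAtom n G)} (hX : FaceAtom.cyl i (X ∩ {a | ∀ j, j ≠ i → ¬ a.rel i j}) ∈ μ) :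
    ∃ ν, X ∈ ν ∧ Valid Λ (.ext s i ν) := by
  have himg : FaceAtom.trace i '' (X ∩ {a | ∀ j, j ≠ i → ¬ a.rel i j}) ∈
      μ.map (FaceAtom.trace i) := by
    refine Ultrafilter.mem_map.2 (mem_of_superset hX ?_)
    rintro a ⟨x, hx, hxa⟩
    exact ⟨x, hx, hxa⟩
  let ν := Ultrafilter.ofComapInfPrincipal himg
  have hν : ν.map (FaceAtom.trace i) = μ.map (FaceAtom.trace i) :=
    Ultrafilter.ofComapInfPrincipal_eq_of_map himg
  have hXν : X ∩ {a | ∀ j, j ≠ i → ¬ a.rel i j} ∈ ν := Ultrafilter.ofComapInfPrincipal_mem himg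
  refine ⟨ν, mem_of_superset hXν Set.inter_subset_left, .ext s i ν hv ?_ ?_ ?_⟩
  · intro k l hk hl
    rw [← hs.rel k l]
    have : ∀ κ : Ultrafilter (FaceAtom n G), (∀ᶠ a : FaceAtom n G in κ, a.rel k l) ↔
        {p : (Fin n → Fin n → Prop) × V | p.1 k l} ∈ κ.map (FaceAtom.trace i) := by
      intro κ
      refine eventually_congr (Eventually.of_forall fun a => ?_)
      exact (and_iff_right hk).trans (and_iff_right hl) |>.symm
    rw [this, this, hν]
  · intro k hk h
    obtain ⟨a, ⟨-, ha⟩, ha'⟩ := ν.nonempty_of_mem (inter_mem hXν h)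
    exact ha k hk ha'
  · rw [← hs.lab]
    exact congrArg (Ultrafilter.map Prod.snd) hν

theorem FaceAtom.representable (hn : 2 < n) (hD : ∃ D, IsDefaultSet n G D) :
    (cmOf n (FaceAtom n G)).Representable := by
  classical
  obtain ⟨D, hD⟩ := hD
  obtain ⟨Λ, hΛ⟩ := hD.exists_isLabelling
  choose μ hμ hμtup using fun s : Fin n → {x // Valid Λ x} =>
    exists_describes_tup hn hΛ (s := fun j => (s j : Pt n (FaceAtom n G))) fun j => (s j).2
  have hcyl : ∀ s i (X : Set (FaceAtom n G)), FaceAtom.cyl i X ∈ μ s ↔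
      ∃ t, X ∈ μ t ∧ ∀ j, j ≠ i → t j = s j := by
    intro s i X
    constructor
    · intro hX
      by_cases hnew : FaceAtom.cyl i (X ∩ {a | ∀ j, j ≠ i → ¬ a.rel i j}) ∈ μ s
      · obtain ⟨ν, hXν, hz⟩ := (hμ s).exists_valid (fun j => (s j).2) hnew
        refine ⟨Function.update s i ⟨_, hz⟩, ?_, fun j hj => Function.update_of_ne hj ..⟩
        rwa [hμtup _ (fun j => (s j : Pt n (FaceAtom n G))) i ν]
        funext j
        by_cases hj : j = i
        · subst hj
          simp
        · rw [Pt.tup_of_ne _ hj, Function.update_of_ne hj]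
      · have hold : ∀ᶠ a : FaceAtom n G in μ s, ∃ j, j ≠ i ∧
            a ∈ FaceAtom.cyl i (X ∩ {a | a.rel i j}) := by
          filter_upwards [hX, Ultrafilter.eventually_not.2 hnew] with a ⟨x, hx, hxa⟩ ha
          by_contra hcon
          push Not at hcon
          exact ha ⟨x, ⟨hx, fun j hj hij => hcon j hj ⟨x, ⟨hx, hij⟩, hxa⟩⟩, hxa⟩
        obtain ⟨j, hj⟩ := Ultrafilter.eventually_exists_iff.1 hold
        have hji : j ≠ i := hj.exists.choose_spec.1
        refine ⟨Function.update s i (s j), ?_, fun k hk => Function.update_of_ne hk ..⟩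
        refine (hμ s).mem_of_cyl_diag_mem hji.symm ?_ (hj.mono fun a ha => ha.2)
        convert hμ (Function.update s i (s j)) using 1
        funext k
        by_cases hk : k = i
        · subst hk
          simp
        · rw [Function.update_of_ne hk, Function.update_of_ne hk]
    · rintro ⟨t, hX, ht⟩
      exact (hμ s).cyl_mem (hμ t) (fun j hj => congrArg _ (ht j hj)) hX
  refine representable_of_ultrafilters μ _ _ FaceAtom.cmOf_d FaceAtom.cmOf_c
    (fun s i j => ((hμ s).rel i j).trans Subtype.coe_inj) hcyl ?_
  let o : Fin n := ⟨0, by omega⟩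
  have key : ∀ (J : Finset (Fin n)) (a : FaceAtom n G), (∀ k, k ∉ J → a.rel k o) →
      ∃ s, {a} ∈ μ s := by
    intro J
    induction J using Finset.induction_on with
    | empty =>
      intro a ha
      refine ⟨fun _ => ⟨.root, .root⟩, mem_of_superset (hμ _).eventually_rel_iff ?_⟩
      intro b hb
      have hb' : ∀ k l, b.rel k l := fun k l => (hb k l).2 rfl
      have ha' : ∀ k l, a.rel k l := fun k l =>
        a.rel.trans (ha k (by simp)) (a.rel.symm (ha l (by simp)))
      have hdef : ∀ c : FaceAtom n G, (∀ k l, c.rel k l) → ∀ i, c.lab i = default := by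
        intro c hc i
        have h2 : 1 < (Finset.univ.erase i).card := by simp; omega
        obtain ⟨l, hl, m, hm, hlm⟩ := Finset.one_lt_card.1 h2
        exact c.lab_default i l m (Finset.ne_of_mem_erase hl) (Finset.ne_of_mem_erase hm) hlm
          (hc l m)
      refine FaceAtom.ext (Setoid.ext fun k l => iff_of_true (hb' k l) (ha' k l)) (funext fun i => ?_)
      rw [hdef b hb', hdef a ha']
    | insert i J _ ih =>
      intro a ha
      by_cases hi : i = o
      · refine ih a fun k hk => ?_
        by_cases hk' : k = i
        · rw [hk', hi]
        · exact ha k (by simp [hk, hk'])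
      · obtain ⟨b, hb, hio⟩ := a.exists_rel_trace_eq hi
        obtain ⟨s, hs⟩ := ih b fun k hk => by
          by_cases hk' : k = i
          · rwa [hk']
          · exact ((FaceAtom.trace_eq_iff.1 hb).1 k o hk' (Ne.symm hi)).2 (ha k (by simp [hk, hk']))
        have : FaceAtom.cyl i {a} ∈ μ s := by
          refine mem_of_superset hs ?_
          rintro _ rfl
          exact ⟨a, rfl, hb.symm⟩
        obtain ⟨t, ht, -⟩ := (hcyl s i {a}).1 this
        exact ⟨t, ht⟩
  exact fun a => key Finset.univ a fun k hk => absurd (Finset.mem_univ k) hk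

end Network

/-! ### Powers of an ultrafilter -/

namespace Ultrafilter

open Filter

variable {X : Type} (U : Ultrafilter X)

/-- The `m`-th tensor power of an ultrafilter. -/
noncomputable def tensorPow : (m : ℕ) → Ultrafilter (Fin m → X)
  | 0 => pure finZeroElim
  | m + 1 => U.bind fun a => (tensorPow m).map fun g => Fin.cons a g

theorem eventually_tensorPow_succ {m : ℕ} {P : (Fin (m + 1) → X) → Prop} :
    (∀ᶠ g : Fin (m + 1) → X in U.tensorPow (m + 1), P g) ↔
      ∀ᶠ a in U, ∀ᶠ g : Fin m → X in U.tensorPow m, P (Fin.cons a g) := Iff.rfl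

variable {U}

theorem eventually_tensorPow_removeNth {m : ℕ} (i : Fin (m + 1)) {P : (Fin m → X) → Prop}
    (h : ∀ᶠ g : Fin m → X in U.tensorPow m, P g) :
    ∀ᶠ g : Fin (m + 1) → X in U.tensorPow (m + 1), P (i.removeNth g) := by
  induction m with
  | zero =>
    have hP : ∀ g, P g := fun g => by
      obtain ⟨g', hg'⟩ := h.exists
      rwa [Subsingleton.elim g g']
    exact Eventually.of_forall fun g => hP _
  | succ m ih =>
    rw [eventually_tensorPow_succ]
    cases i using Fin.cases with
    | zero => exact Eventually.of_forall fun a => by simpa using h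
    | succ j =>
      rw [eventually_tensorPow_succ] at h
      refine h.mono fun a ha => (ih j ha).mono fun g hg => ?_
      convert hg using 1
      ext k
      cases k using Fin.cases <;> simp [Fin.removeNth]

theorem eventually_tensorPow_forall {P : X → Prop} (h : ∀ᶠ a in U, P a) (m : ℕ) :
    ∀ᶠ g : Fin m → X in U.tensorPow m, ∀ i, P (g i) := by
  induction m with
  | zero => exact Eventually.of_forall fun g i => i.elim0
  | succ m ih =>
    rw [eventually_tensorPow_succ]
    refine h.mono fun a ha => ih.mono fun g hg => ?_
    rw [Fin.forall_fin_succ]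
    exact ⟨ha, hg⟩

theorem eventually_tensorPow_injective (hU : ∀ x, ∀ᶠ a : X in U, a ≠ x) (m : ℕ) :
    ∀ᶠ g : Fin m → X in U.tensorPow m, Function.Injective g := by
  induction m with
  | zero => exact Eventually.of_forall fun g => Function.injective_of_subsingleton g
  | succ m ih =>
    rw [eventually_tensorPow_succ]
    refine Eventually.of_forall fun a => ?_
    filter_upwards [ih, eventually_tensorPow_forall (hU a) m] with g hg hga
    exact Fin.cons_injective_iff.2 ⟨fun ⟨i, hi⟩ => hga i hi, hg⟩

theorem eventually_hyperfilter_ne [Infinite X] (x : X) : ∀ᶠ a in hyperfilter X, a ≠ x :=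
  (Set.finite_singleton x).compl_mem_hyperfilter

end Ultrafilter

/-! ### Shift graphs -/

section Shift

open Filter

/-- The sequence `y` is a shift of the sequence `x` up to the index `k`, and both are injective up
to this index. -/
def IsShift (k : ℕ) (x y : ℕ → ℕ) : Prop :=
  Set.InjOn x (Set.Iic k) ∧ Set.InjOn y (Set.Iic k) ∧ ∀ i < k, y i = x (i + 1)

/-- The shift graph on the sequences that are injective up to the index `k`. -/
def shiftGraph (k : ℕ) : SimpleGraph (ℕ → ℕ) := SimpleGraph.fromRel (IsShift k)

/-- The continuation of a tuple by zeros. -/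
def extendZero {k : ℕ} (g : Fin k → ℕ) (i : ℕ) : ℕ := if h : i < k then g ⟨i, h⟩ else 0

theorem injOn_extendZero {k : ℕ} {g : Fin (k + 1) → ℕ} (hg : Function.Injective g) :
    Set.InjOn (extendZero g) (Set.Iic k) := by
  intro i hi j hj h
  have hi' : i < k + 1 := Nat.lt_succ_of_le hi
  have hj' : j < k + 1 := Nat.lt_succ_of_le hj
  simp only [extendZero, hi', hj', dif_pos] at h
  exact congrArg Fin.val (hg h)

theorem shiftGraph_adj_removeNth {k : ℕ} {g : Fin (k + 2) → ℕ} (hg : Function.Injective g) :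
    (shiftGraph k).Adj (extendZero ((Fin.last _).removeNth g))
      (extendZero ((0 : Fin (k + 2)).removeNth g)) := by
  refine (SimpleGraph.fromRel_adj ..).2 ⟨fun h => ?_, Or.inl ⟨?_, ?_, fun i hi => ?_⟩⟩
  · have := congrFun h 0
    simp only [extendZero, Nat.zero_lt_succ, dif_pos, Fin.removeNth] at this
    simpa [Fin.ext_iff] using hg this
  · exact injOn_extendZero (hg.comp Fin.succAbove_right_injective)
  · exact injOn_extendZero (hg.comp Fin.succAbove_right_injective)
  · have h1 : i < k + 1 := by omega
    have h2 : i + 1 < k + 1 := by omega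
    simp only [extendZero, h1, h2, dif_pos, Fin.removeNth]
    congr 1
    simp

theorem exists_ultrafilterAdj_shiftGraph (k : ℕ) :
    ∃ p, UltrafilterAdj (shiftGraph k) p p := by
  let U := (hyperfilter ℕ).tensorPow (k + 1)
  refine ⟨U.map extendZero, fun A hA B hB => ?_⟩
  have hA' : ∀ᶠ g : Fin (k + 1) → ℕ in U, extendZero g ∈ A := hA
  have hB' : ∀ᶠ g : Fin (k + 1) → ℕ in U, extendZero g ∈ B := hB
  obtain ⟨g, ⟨hgA, hgB⟩, hg⟩ :=
    (((Ultrafilter.eventually_tensorPow_removeNth (Fin.last _) hA').and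
      (Ultrafilter.eventually_tensorPow_removeNth 0 hB')).and
      (Ultrafilter.eventually_tensorPow_injective Ultrafilter.eventually_hyperfilter_ne _)).exists
  exact ⟨_, hgA, _, hgB, shiftGraph_adj_removeNth hg⟩

end Shift

/-! ### Copies of a graph -/

section Copies

variable {V C : Type} {G : SimpleGraph V}

/-- The join of copies of the graph `G` that are indexed by `C`. -/
def copies (G : SimpleGraph V) (C : Type) : SimpleGraph (V × C) where
  Adj u v := u.2 ≠ v.2 ∨ G.Adj u.1 v.1
  symm := ⟨fun _ _ h => h.imp Ne.symm SimpleGraph.Adj.symm⟩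
  loopless := ⟨fun _ h => h.elim (fun h => h rfl) (G.loopless.irrefl _)⟩

theorem isDefaultSet_copies {n : ℕ} [Fintype C] (hC : n * n < Fintype.card C) {p : Ultrafilter V}
    (hp : UltrafilterAdj G p p) :
    IsDefaultSet n (copies G C) (Set.range fun c => p.map fun v => (v, c)) := by
  classical
  refine ⟨?_, fun 𝓕 h𝓕 => ?_⟩
  · rintro _ ⟨c, rfl⟩ _ ⟨c', rfl⟩ A hA B hB
    obtain ⟨v, hv, w, hw, h⟩ := hp _ hA _ hB
    exact ⟨_, hv, _, hw, Or.inr h⟩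
  · have hpure : ∀ q : Ultrafilter (V × C), ∃ c, q.map Prod.snd = pure c := fun q =>
      Ultrafilter.eq_pure_of_finite _
    choose c hc using hpure
    obtain ⟨e, he⟩ : ∃ e, e ∉ 𝓕.image c := by
      by_contra! h
      have := Finset.card_le_card fun x (_ : x ∈ Finset.univ) => h x
      have := Finset.card_image_le (s := 𝓕) (f := c)
      rw [Finset.card_univ] at *
      omega
    refine ⟨_, ⟨e, rfl⟩, fun q hq A hA B hB => ?_⟩
    obtain ⟨v, hv⟩ := p.nonempty_of_mem hA
    have hmem : {w : V × C | w.2 = c q} ∈ q := by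
      have : ({c q} : Set C) ∈ q.map Prod.snd := by rw [hc]; exact Ultrafilter.mem_pure.2 rfl
      exact this
    obtain ⟨w, hwB, hw⟩ := q.nonempty_of_mem (Filter.inter_mem hB hmem)
    refine ⟨_, hv, w, hwB, Or.inl fun h => he (Finset.mem_image.2 ⟨q, hq, ?_⟩)⟩
    exact (h.trans hw).symm

theorem representable_copies {n : ℕ} (hn : 2 < n) [Inhabited V] [Inhabited C] [Fintype C]
    (hC : n * n < Fintype.card C) (hp : ∃ p, UltrafilterAdj G p p) :
    (cmOf n (FaceAtom n (copies G C))).Representable :=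
  let ⟨_, hp⟩ := hp
  FaceAtom.representable hn ⟨_, isDefaultSet_copies hC hp⟩

end Copies

/-! ### Colourings that exclude representations -/

section Coloring

open Filter

theorem Fin.predAbove_succ_succAbove {m : ℕ} (i k : Fin m) :
    i.predAbove (i.succ.succAbove k) = k := by
  rcases lt_or_ge i k with h | h
  · rw [Fin.succAbove_of_le_castSucc _ _ (Fin.succ_le_castSucc_iff.2 h),
      Fin.predAbove_of_castSucc_lt _ _ (Fin.castSucc_lt_succ_iff.2 h.le), Fin.pred_succ]
  · rw [Fin.succAbove_of_castSucc_lt _ _ (Fin.castSucc_lt_succ_iff.2 h),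
      Fin.predAbove_of_le_castSucc _ _ (Fin.castSucc_le_castSucc_iff.2 h), Fin.castPred_castSucc]

variable {m : ℕ} {κ U : Type}

/-- A colouring of the faces of all sequences over an infinite set is constant on the faces of some
injective sequence, provided that the colour of the `i`-th face does not depend on the `i`-th entry
and that deleting one of two adjacent equal entries gives the same colour. -/
theorem exists_injective_face_color_eq [Finite κ] [Infinite U]
    (χ : Fin (m + 1) → (Fin (m + 1) → U) → κ)
    (hcyl : ∀ i s t, (∀ j, j ≠ i → t j = s j) → χ i s = χ i t)
    (hdiag : ∀ (i : Fin m) s, s i.castSucc = s i.succ → χ i.castSucc s = χ i.succ s) :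
    ∃ s k, Function.Injective s ∧ ∀ i, χ i s = k := by
  classical
  obtain ⟨u⟩ := (inferInstance : Nonempty U)
  have hins : ∀ i (g : Fin m → U) t, (∀ k, t (i.succAbove k) = g k) →
      χ i (i.insertNth u g) = χ i t := by
    intro i g t ht
    refine hcyl _ _ _ fun j hj => ?_
    obtain ⟨k, rfl⟩ := Fin.exists_succAbove_eq hj
    rw [Fin.insertNth_apply_succAbove, ht]
  have hD : ∀ i (g : Fin m → U), χ i (i.insertNth u g) = χ 0 ((0 : Fin (m + 1)).insertNth u g) := by
    intro i g
    induction i using Fin.induction with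
    | zero => rfl
    | succ i ih =>
      rw [← ih, hins i.castSucc g (fun k => g (i.predAbove k)) fun k => by
          rw [Fin.predAbove_succAbove],
        hins i.succ g (fun k => g (i.predAbove k)) fun k => by
          rw [Fin.predAbove_succ_succAbove]]
      exact (hdiag i _ (by simp)).symm
  obtain ⟨k, hk⟩ := Ultrafilter.eq_pure_of_finite
    (((hyperfilter U).tensorPow m).map fun g => χ 0 ((0 : Fin (m + 1)).insertNth u g))
  have hk' : ∀ᶠ g : Fin m → U in (hyperfilter U).tensorPow m,
      χ 0 ((0 : Fin (m + 1)).insertNth u g) = k := by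
    have : ({k} : Set κ) ∈ ((hyperfilter U).tensorPow m).map
        fun g => χ 0 ((0 : Fin (m + 1)).insertNth u g) := hk ▸ Ultrafilter.mem_pure.2 rfl
    exact this
  obtain ⟨s, hs, hinj⟩ := ((eventually_all.2 fun i : Fin (m + 1) =>
    Ultrafilter.eventually_tensorPow_removeNth i hk').and
    (Ultrafilter.eventually_tensorPow_injective Ultrafilter.eventually_hyperfilter_ne _)).exists
  exact ⟨s, k, hinj, fun i => by rw [← hs i, ← hD i]; exact (hins i _ s fun _ => rfl).symm⟩

/-- A finite colouring of the faces of the atoms that is not constant on any nondegenerate atom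
excludes representations, which have an infinite base if some atom has infinitely many
neighbours. -/
theorem not_representable_of_coloring {B : Type} [str : (atomLang (m + 1)).Structure B] [Finite κ]
    {c : Fin (m + 1) → Set B → Set B} {d : Fin (m + 1) → Fin (m + 1) → Set B}
    (hc : (cmOf (m + 1) B).c = c) (hd : (cmOf (m + 1) B).d = d) (col : Fin (m + 1) → B → κ)
    (hcyl : ∀ i k, c i {a | col i a = k} ⊆ {a | col i a = k})
    (hdiag : ∀ i : Fin m, ∀ a ∈ d i.castSucc i.succ, col i.castSucc a = col i.succ a)
    (hcol : ∀ a k, (∀ i j, i ≠ j → a ∉ d i j) → ¬ ∀ i, col i a = k)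
    (hinf : ∃ a l, {b | a ∈ c l {b}}.Infinite) : ¬ (cmOf (m + 1) B).Representable := by
  classical
  rintro ⟨I, W, f, hinj, hadd, hmul, hneg, h0, h1, hfc, hfd⟩
  obtain ⟨a, l, hal⟩ := hinf
  obtain ⟨x, s₀, hs₀⟩ : ∃ x s, s ∈ (show Set (Fin (m + 1) → W x) from f ({a} : Set B) x) := by
    by_contra! h
    refine Set.singleton_ne_empty a (hinj (funext fun x => ?_))
    refine Eq.trans ?_ (congrFun h0 x).symm
    exact Set.eq_empty_of_forall_notMem (h x)
  let F : Set B → Set (Fin (m + 1) → W x) := fun X => f X x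
  have hFinter : ∀ X Y, F (X ∩ Y) = F X ∩ F Y := fun X Y => congrFun (hmul X Y) x
  have hFcompl : ∀ X, F Xᶜ = (F X)ᶜ := fun X => congrFun (hneg X) x
  have hFuniv : F Set.univ = Set.univ := congrFun h1 x
  have hFc : ∀ i X, F (c i X) = cylSet _ _ i (F X) := fun i X => by
    rw [← hc]
    exact congrFun (hfc i X) x
  have hFd : ∀ i j s, s ∈ F (d i j) ↔ s i = s j := fun i j s => by
    rw [← hd]
    exact Set.ext_iff.1 (congrFun (hfd i j) x) s
  have hmono : ∀ {X Y}, X ⊆ Y → F X ⊆ F Y := fun {X Y} h => by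
    rw [← Set.inter_eq_left.2 h, hFinter]
    exact Set.inter_subset_right
  obtain ⟨μ, hμ⟩ : ∃ μ : (Fin (m + 1) → W x) → Ultrafilter B, ∀ s X, X ∈ μ s ↔ s ∈ F X := by
    refine ⟨fun s => Ultrafilter.ofComplNotMemIff
      { sets := {X | s ∈ F X}
        univ_sets := by simp [hFuniv]
        sets_of_superset := fun hX h => hmono h hX
        inter_sets := fun hX hY => by
          simp only [Set.mem_ofPred_eq, hFinter]
          exact ⟨hX, hY⟩ } fun X => ?_, fun s X => Iff.rfl⟩
    change s ∉ F Xᶜ ↔ s ∈ F X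
    rw [hFcompl, Set.notMem_compl_iff]
  have hmeet : ∀ {s X Y}, s ∈ F X → s ∈ F Y → (X ∩ Y).Nonempty := fun {s X Y} hX hY =>
    (μ s).nonempty_of_mem (inter_mem ((hμ s X).2 hX) ((hμ s Y).2 hY))
  have hcolor : ∀ i s, ∃ k, s ∈ F {a | col i a = k} := by
    intro i s
    obtain ⟨k, hk⟩ := Ultrafilter.eq_pure_of_finite ((μ s).map (col i))
    have : ({k} : Set κ) ∈ (μ s).map (col i) := hk ▸ Ultrafilter.mem_pure.2 rfl
    exact ⟨k, (hμ s _).1 this⟩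
  choose χ hχ using hcolor
  have hinfinite : Infinite (W x) := by
    have hwit : ∀ b : {b | a ∈ c l {b}}, ∃ t ∈ F {(b : B)}, ∀ j, j ≠ l → t j = s₀ j := fun b => by
      have : s₀ ∈ F (c l {(b : B)}) := hmono (Set.singleton_subset_iff.2 (show a ∈ c l {(b : B)} from b.2)) hs₀
      rwa [hFc] at this
    choose t ht hts using hwit
    have := hal.to_subtype
    refine Infinite.of_injective (fun b => t b l) fun b b' h => ?_
    have htt : t b = t b' := funext fun j => by
      by_cases hj : j = l
      · rw [hj]
        exact h
      · rw [hts b j hj, hts b' j hj]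
    obtain ⟨_, rfl, h⟩ := hmeet (htt ▸ ht b) (ht b')
    exact Subtype.ext h
  obtain ⟨s, k, hs, hsk⟩ := exists_injective_face_color_eq χ
    (fun i s t hst => by
      have : s ∈ F (c i {a | col i a = χ i t}) := by
        rw [hFc]
        exact ⟨t, hχ i t, hst⟩
      obtain ⟨b, hb, hb'⟩ := hmeet (hχ i s) (hmono (hcyl i _) this)
      exact hb.symm.trans hb')
    (fun i s hs => by
      have : s ∈ F (d i.castSucc i.succ ∩ {a | col i.succ a = χ i.succ s}) := by
        rw [hFinter]
        exact ⟨(hFd _ _ s).2 hs, hχ i.succ s⟩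
      obtain ⟨b, hb, hbd, hb'⟩ := hmeet (hχ i.castSucc s) this
      exact hb.symm.trans ((hdiag i b hbd).trans hb'))
  have h1 : ∀ᶠ b in μ s, ∀ i, col i b = k := eventually_all.2 fun i =>
    (hμ s _).2 (hsk i ▸ hχ i s)
  have h2 : ∀ᶠ b in μ s, ∀ i j, i ≠ j → b ∉ d i j := by
    refine eventually_all.2 fun i => eventually_all.2 fun j => ?_
    by_cases hij : i = j
    · exact Eventually.of_forall fun _ h => absurd hij h
    · have : (d i j)ᶜ ∈ μ s := by
        rw [hμ, hFcompl]
        exact fun h => hij (hs ((hFd i j s).1 h))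
      filter_upwards [this] with b hb _ using hb
  obtain ⟨b, hb, hb'⟩ := (h1.and h2).exists
  exact hcol b k hb' hb

end Coloring

/-! ### Colouring ultraproducts of shift graphs -/

section Ultraproduct

open Filter

theorem shiftGraph_walk {k : ℕ} {x y : ℕ → ℕ} (w : (shiftGraph k).Walk x y) :
    ∃ a b, a + b = w.length ∧ ∀ i, i + a + b ≤ k → y (i + b) = x (i + a) := by
  induction w with
  | nil => exact ⟨0, 0, rfl, fun _ _ => rfl⟩
  | cons h w ih =>
    obtain ⟨a, b, hab, hw⟩ := ih
    rcases ((SimpleGraph.fromRel_adj ..).1 h).2 with ⟨-, -, hs⟩ | ⟨-, -, hs⟩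
    · refine ⟨a + 1, b, by rw [SimpleGraph.Walk.length_cons]; omega, fun i hi => ?_⟩
      rw [hw i (by omega), hs _ (by omega), add_assoc]
    · refine ⟨a, b + 1, by rw [SimpleGraph.Walk.length_cons]; omega, fun i hi => ?_⟩
      rw [hs _ (by omega), add_right_comm, ← hw (i + 1) (by omega), ← add_assoc, add_right_comm]

theorem even_length_shiftGraph_walk {k : ℕ} {x : ℕ → ℕ} (w : (shiftGraph k).Walk x x)
    (hk : w.length ≤ k) : Even w.length := by
  cases w with
  | nil => exact ⟨0, rfl⟩
  | cons h w =>
    have hx : Set.InjOn x (Set.Iic k) := by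
      rcases ((SimpleGraph.fromRel_adj ..).1 h).2 with ⟨hx, -⟩ | ⟨-, hx, -⟩ <;> exact hx
    obtain ⟨a, b, hab, hw⟩ := shiftGraph_walk (SimpleGraph.Walk.cons h w)
    have := hx (Set.mem_Iic.2 (by omega)) (Set.mem_Iic.2 (by omega)) (hw 0 (by omega))
    exact ⟨a, by omega⟩

/-- The graph of all sequences of vertices that are adjacent almost everywhere. -/
def germGraph {V : Type} (U : Ultrafilter ℕ) (G : ℕ → SimpleGraph V) : SimpleGraph (ℕ → V) where
  Adj f g := ∀ᶠ k in U, (G k).Adj (f k) (g k)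
  symm := ⟨fun _ _ h => h.mono fun _ h => h.symm⟩
  loopless := ⟨fun _ h => let ⟨k, hk⟩ := h.exists; (G k).loopless.irrefl _ hk⟩

theorem germGraph_walk {V : Type} {U : Ultrafilter ℕ} {G : ℕ → SimpleGraph V} {f g : ℕ → V}
    (w : (germGraph U G).Walk f g) :
    ∀ᶠ k in U, ∃ w' : (G k).Walk (f k) (g k), w'.length = w.length := by
  induction w with
  | nil => exact Eventually.of_forall fun _ => ⟨.nil, rfl⟩
  | cons h w ih =>
    filter_upwards [h, ih] with k hk ⟨w', hlen⟩
    exact ⟨.cons hk w', by simp [hlen]⟩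

/-- Sequences of vertices have a finite colouring that is proper for almost everywhere adjacency. -/
structure IsGermColoring {V κ : Type} (U : Ultrafilter ℕ) (G : ℕ → SimpleGraph V)
    (χ : (ℕ → V) → κ) : Prop where
  congr : ∀ f g, (∀ᶠ k in U, f k = g k) → χ f = χ g
  ne : ∀ f g, (∀ᶠ k in U, (G k).Adj (f k) (g k)) → χ f ≠ χ g

theorem exists_isGermColoring_shiftGraph {U : Ultrafilter ℕ} (hU : (U : Filter ℕ) ≤ atTop) :
    ∃ χ : (ℕ → ℕ → ℕ) → Fin 2, IsGermColoring U shiftGraph χ := by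
  obtain ⟨χ⟩ : (germGraph U shiftGraph).Colorable 2 := by
    refine SimpleGraph.two_colorable_iff_forall_loop_even.2 fun f w => ?_
    obtain ⟨k, ⟨w', hw'⟩, hk⟩ := ((germGraph_walk w).and (hU (eventually_ge_atTop w.length))).exists
    rw [← hw'] at hk ⊢
    exact even_length_shiftGraph_walk w' hk
  have hout : ∀ f : ℕ → ℕ → ℕ,
      ∀ᶠ k in U, Quotient.out (f : (U : Filter ℕ).Germ (ℕ → ℕ)) k = f k := fun f =>
    Quotient.exact (Quotient.out_eq (f : (U : Filter ℕ).Germ (ℕ → ℕ)))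
  refine ⟨fun f => χ (Quotient.out (f : (U : Filter ℕ).Germ (ℕ → ℕ))), fun f g h => ?_,
    fun f g h => χ.valid ?_⟩
  · rw [Germ.coe_eq.2 h]
  · filter_upwards [h, hout f, hout g] with k hk hf hg
    rwa [hf, hg]

theorem IsGermColoring.exists_copies {V κ C : Type} [Finite C] {U : Ultrafilter ℕ}
    {G : ℕ → SimpleGraph V} {χ : (ℕ → V) → κ} (hχ : IsGermColoring U G χ) :
    ∃ χ' : (ℕ → V × C) → κ × C, IsGermColoring U (fun k => copies (G k) C) χ' := by
  have hlim : ∀ f : ℕ → V × C, ∃ c, ∀ᶠ k in U, (f k).2 = c := fun f => by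
    obtain ⟨c, hc⟩ := Ultrafilter.eq_pure_of_finite (U.map fun k => (f k).2)
    have : ({c} : Set C) ∈ U.map fun k => (f k).2 := hc ▸ Ultrafilter.mem_pure.2 rfl
    exact ⟨c, this⟩
  choose c hc using hlim
  refine ⟨fun f => (χ fun k => (f k).1, c f), fun f g h => Prod.ext ?_ ?_, fun f g h hfg => ?_⟩
  · exact hχ.congr _ _ (h.mono fun k hk => congrArg Prod.fst hk)
  · obtain ⟨k, ⟨hk, hf⟩, hg⟩ := ((h.and (hc f)).and (hc g)).exists
    exact hf.symm.trans ((congrArg Prod.snd hk).trans hg)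
  · obtain ⟨h1, h2⟩ := Prod.ext_iff.1 hfg
    refine hχ.ne _ _ ?_ h1
    filter_upwards [h, hc f, hc g] with k hk hf hg
    exact hk.resolve_left fun h => h (hf.trans (h2.trans hg.symm))

/-! ### The ultraproduct of the atom structures -/

variable {V κ : Type} [Inhabited V] {m : ℕ} (U : Ultrafilter ℕ) (G : ℕ → SimpleGraph V)

/-- The ultraproduct of the atom structures of a sequence of graphs. -/
abbrev AtomProduct (n : ℕ) : Type := (U : Filter ℕ).Product fun k => FaceAtom n (G k)

variable {U G} {n : ℕ}

theorem atomProduct_mk_eq {x y : ∀ k, FaceAtom n (G k)} :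
    ((x : AtomProduct U G n) = (y : AtomProduct U G n)) ↔ ∀ᶠ k in U, x k = y k := Quotient.eq

theorem atomProduct_out (x : ∀ k, FaceAtom n (G k)) :
    ∀ᶠ k in U, Quotient.out (x : AtomProduct U G n) k = x k :=
  atomProduct_mk_eq.1 (Quotient.out_eq _)

theorem atomProduct_cmOf_c : (cmOf n (AtomProduct U G n)).c =
    fun i (X : Set (AtomProduct U G n)) => {b : AtomProduct U G n | ∃ a ∈ X, ∀ᶠ k in U,
      FaceAtom.trace i (Quotient.out a k) = FaceAtom.trace i (Quotient.out b k)} := by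
  funext i X
  refine Set.ext fun b : AtomProduct U G n => ?_
  refine exists_congr fun a : AtomProduct U G n => and_congr_right fun _ => ?_
  have h : (![a, b] : Fin 2 → AtomProduct U G n) = fun j =>
      ((![Quotient.out a, Quotient.out b] j : ∀ k, FaceAtom n (G k)) : AtomProduct U G n) := by
    funext j
    fin_cases j
    · exact (Quotient.out_eq a).symm
    · exact (Quotient.out_eq b).symm
  rw [h]
  exact FirstOrder.Language.relMap_quotient_mk' ..

theorem atomProduct_cmOf_d : (cmOf n (AtomProduct U G n)).d = fun i j =>
    {a : AtomProduct U G n | ∀ᶠ k in U, (Quotient.out a k).rel i j} := by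
  funext i j
  refine Set.ext fun a : AtomProduct U G n => ?_
  have h : (![a] : Fin 1 → AtomProduct U G n) = fun j =>
      ((![Quotient.out a] j : ∀ k, FaceAtom n (G k)) : AtomProduct U G n) := by
    funext j
    fin_cases j
    exact (Quotient.out_eq a).symm
  change FirstOrder.Language.Structure.RelMap (L := atomLang n) (n := 1) (i, j) ![a] ↔ _
  rw [h]
  exact Iff.trans (FirstOrder.Language.relMap_quotient_mk' ..) Iff.rfl

/-- A nondegenerate atom all of whose faces but the first one have the same label. -/
def starAtom (hm : 0 < m) (G : SimpleGraph V) (v : V) (hv : G.Adj default v) :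
    FaceAtom (m + 1) G where
  rel := ⊥
  lab i := if i = 0 then default else v
  lab_default _ _ _ _ _ hkl h := absurd h hkl
  lab_congr _ _ h := by rw [show _ = _ from h]
  edge _ := ⟨0, Fin.last m, by simpa [hm.ne'] using hv⟩

theorem not_representable_atomProduct [Finite κ] (hm : 0 < m) {χ : (ℕ → V) → κ}
    (hχ : IsGermColoring U G χ) {S : Set V} (hS : S.Infinite)
    (hadj : ∀ k, ∀ v ∈ S, (G k).Adj default v) :
    ¬ (cmOf (m + 1) (AtomProduct U G (m + 1))).Representable := by
  refine not_representable_of_coloring atomProduct_cmOf_c atomProduct_cmOf_d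
    (fun i a => χ fun k => (Quotient.out a k).lab i) ?_ ?_ ?_ ?_
  · rintro i c b ⟨a, rfl, hab⟩
    exact hχ.congr _ _ (hab.mono fun k hk => ((FaceAtom.trace_eq_iff.1 hk).2).symm)
  · exact fun i a ha => hχ.congr _ _ (ha.mono fun k hk => FaceAtom.lab_congr _ _ _ hk)
  · intro a c hd hc
    have htriv : ∀ᶠ k in U, ∀ i j, (Quotient.out a k).rel i j → i = j := by
      refine eventually_all.2 fun i => eventually_all.2 fun j => ?_
      by_cases hij : i = j
      · exact Eventually.of_forall fun _ _ => hij
      · have := Ultrafilter.eventually_not.2 (hd i j hij)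
        exact this.mono fun k hk h => absurd h hk
    have hedge := htriv.mono fun k hk => (Quotient.out a k).edge hk
    obtain ⟨i, hi⟩ := Ultrafilter.eventually_exists_iff.1 hedge
    obtain ⟨j, hj⟩ := Ultrafilter.eventually_exists_iff.1 hi
    exact hχ.ne _ _ hj ((hc i).trans (hc j).symm)
  · have := hS.to_subtype
    let b : S → AtomProduct U G (m + 1) := fun v =>
      ((fun k => starAtom hm (G k) v (hadj k v v.2) :
        ∀ k, FaceAtom (m + 1) (G k)) : AtomProduct U G (m + 1))
    obtain ⟨v⟩ := (inferInstance : Nonempty S)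
    refine ⟨b v, 0, Set.infinite_of_injective_forall_mem (f := b) (fun x y h => ?_) fun x => ?_⟩
    · obtain ⟨k, hk⟩ := (atomProduct_mk_eq.1 h).exists
      have := congrArg (fun a => FaceAtom.lab a (Fin.last m)) hk
      exact Subtype.ext (by simpa [starAtom, hm.ne'] using this)
    · refine ⟨b x, rfl, ?_⟩
      filter_upwards [atomProduct_out fun k => starAtom hm (G k) x (hadj k x x.2),
        atomProduct_out fun k => starAtom hm (G k) v (hadj k v v.2)] with k hx hv
      rw [hx, hv]
      exact FaceAtom.trace_eq_iff.2 ⟨fun _ _ _ _ => Iff.rfl, rfl⟩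

end Ultraproduct

/-- Let `2 < n < ω`.  The class of strongly representable `CA_n` atom
structures is not elementary:  there is no set of first-order sentences in
the relational signature `(T_i, E_ij)_{i,j<n}` whose models are exactly the
structures `S` whose complex algebra `Cm S` is a representable `CA_n`. -/
theorem strongly_representable_not_elementary (n : ℕ) (hn : 2 < n) :
    ¬ ∃ T : (atomLang n).Theory,
        ∀ (B : Type) (str : (atomLang n).Structure B),
          @FirstOrder.Language.Theory.Model (atomLang n) B str T ↔
            (@cmOf n B str).Representable := by
  rintro ⟨T, hT⟩
  obtain ⟨m, rfl⟩ : ∃ m, n = m + 1 := ⟨n - 1, by omega⟩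
  have : Fact (2 < m + 1) := ⟨hn⟩
  let C := Fin ((m + 1) * (m + 1) + 1)
  let U : Ultrafilter ℕ := Filter.hyperfilter ℕ
  obtain ⟨χ, hχ⟩ := exists_isGermColoring_shiftGraph (U := U) Nat.hyperfilter_le_atTop
  obtain ⟨χ', hχ'⟩ := hχ.exists_copies (C := C)
  have hmodel : ∀ k, FaceAtom (m + 1) (copies (shiftGraph k) C) ⊨ T := fun k =>
    (hT _ _).2 (representable_copies hn (by simp [C]) (exists_ultrafilterAdj_shiftGraph k))
  have hprod : AtomProduct U (fun k => copies (shiftGraph k) C) (m + 1) ⊨ T :=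
    ⟨fun φ hφ => FirstOrder.Language.Ultraproduct.sentence_realize φ |>.2
      (Filter.Eventually.of_forall fun k => (hmodel k).realize_of_mem φ hφ)⟩
  have hinj : Function.Injective fun γ : ℕ → ℕ => (γ, (1 : C)) := Prod.mk_left_injective 1
  refine not_representable_atomProduct (by omega) hχ' (Set.infinite_range_of_injective hinj) ?_
    ((hT _ _).1 hprod)
  rintro k _ ⟨γ, rfl⟩
  refine Or.inl (show (0 : C) ≠ 1 from fun h => ?_)
  simpa [C] using congrArg Fin.val h
end
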